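/- Let σ ≤ 0, d > 0, and θ be fixed real numbers, fix α ∈ (0,1] and constants C_2 > C_1 > 1, let c > 0 be a sufficiently large constant depending on d, θ, and set D = e^{2πi/8}·d^{1/2−σ} and H = c·(log(MN))^{1+α}. Then for all positive integers M, N with C_1·N ≤ M ≤ C_2·N: Σ_{n=1}^N ζ(σ + 2πidn)·e^{2πiθn}/n^{1−σ} = D·Σ_{m=1}^M (1/m^{1−σ}) Σ_{h ∈ ℤ, |h| ≤ H} ∫_1^N e^{2πi(F_m(u) − hu)}/u^{1/2} du + O(1 + 𝟙(σ = 0)·(log N)^{1−α}), where the implied constant depends only on α, σ, d, θ, C_1, C_2, c. -/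

import Mathlib

/-- `Fm d θ m u = d·u·log(e·m/(d·u)) + θ·u`. -/
noncomputable def Fm (d θ : ℝ) (m : ℕ) (u : ℝ) : ℝ :=
  d * u * Real.log (Real.exp 1 * m / (d * u)) + θ * u


lemma hasSum_eq_aux {E : Type*} [AddCommMonoid E] [TopologicalSpace E] {f : ℕ → E} {a b : E}
    (h : HasSum f a) (e : a = b) : HasSum f b := e ▸ h

open MeasureTheory in
lemma unit_hasSum (n : ℕ) (f f1 f2 : ℝ → ℂ)
    (hf : ∀ x ∈ Set.Icc (n:ℝ) (n+1), HasDerivAt f (f1 x) x)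
    (hf1 : ∀ x ∈ Set.Icc (n:ℝ) (n+1), HasDerivAt f1 (f2 x) x)
    (hf2 : ContinuousOn f2 (Set.Icc (n:ℝ) (n+1))) :
    HasSum (fun k : ℕ => ∫ x in (n:ℝ)..(n+1), f x * (2 * Real.cos (2 * Real.pi * (k+1) * x) : ℝ))
      ((f n + f (n+1)) / 2 - ∫ x in (n:ℝ)..(n+1), f x) := by
  have hle : (n:ℝ) ≤ n + 1 := by linarith
  have huI : Set.uIcc (n:ℝ) (n+1) = Set.Icc (n:ℝ) (n+1) := Set.uIcc_of_le hle
  have hpi : (Real.pi : ℂ) ≠ 0 := by exact_mod_cast Real.pi_ne_zero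
  have hfc : ContinuousOn f (Set.uIcc (n:ℝ) (n+1)) := by
    rw [huI]; exact fun x hx => (hf x hx).continuousAt.continuousWithinAt
  have hf1c : ContinuousOn f1 (Set.uIcc (n:ℝ) (n+1)) := by
    rw [huI]; exact fun x hx => (hf1 x hx).continuousAt.continuousWithinAt
  rw [← huI] at hf hf1 hf2
  -- cos series
  have hcos : ∀ x ∈ Set.Icc (n:ℝ) (n+1),
      HasSum (fun k : ℕ => 1 / ((k:ℝ)+1)^2 * Real.cos (2 * Real.pi * (k+1) * x))
        (Real.pi^2 * ((x-n)^2 - (x-n) + 1/6)) := by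
    intro x hx
    have h := hasSum_one_div_nat_pow_mul_cos (k := 1) one_ne_zero (x := x - n)
      ⟨by linarith [hx.1], by linarith [hx.2]⟩
    rw [← hasSum_nat_add_iff' 1] at h
    have g1 : (fun k : ℕ => 1 / ((k:ℝ)+1)^2 * Real.cos (2 * Real.pi * (k+1) * x)) =
        (fun k : ℕ => 1 / (((k+1 : ℕ):ℝ))^(2*1) * Real.cos (2 * Real.pi * ((k+1:ℕ):ℝ) * (x - n))) := by
      ext k
      push_cast
      rw [show 2 * Real.pi * ((k:ℝ)+1) * (x - n) = 2 * Real.pi * (k+1) * x - ((k+1) * n : ℕ) * (2 * Real.pi) by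
        push_cast; ring, Real.cos_sub_nat_mul_two_pi]
    rw [g1]
    refine hasSum_eq_aux h ?_
    simp [Polynomial.bernoulli, Finset.sum_range_succ, Nat.factorial, bernoulli_two]
    ring
  have hz : HasSum (fun k : ℕ => 1 / ((k:ℝ)+1)^2) (Real.pi^2/6) := by
    have h := hasSum_zeta_two
    rw [← hasSum_nat_add_iff' 1] at h
    simpa using h
  have hsin0 : ∀ (k : ℕ) , Real.sin (2 * Real.pi * (k+1) * n) = 0 := by
    intro k
    rw [show 2 * Real.pi * ((k:ℝ)+1) * n = ((2 * (k+1) * n : ℕ):ℝ) * Real.pi by push_cast; ring]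
    exact Real.sin_nat_mul_pi _
  have hsin1 : ∀ (k : ℕ) , Real.sin (2 * Real.pi * (k+1) * (n+1)) = 0 := by
    intro k; have := hsin0 k
    rw [show 2 * Real.pi * ((k:ℝ)+1) * (n+1) = ((2 * (k+1) * (n+1) : ℕ):ℝ) * Real.pi by push_cast; ring]
    exact Real.sin_nat_mul_pi _
  have hcos0 : ∀ (k : ℕ) , Real.cos (2 * Real.pi * (k+1) * n) = 1 := by
    intro k
    rw [show 2 * Real.pi * ((k:ℝ)+1) * n = (((k+1) * n : ℕ):ℝ) * (2*Real.pi) by push_cast; ring]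
    exact Real.cos_nat_mul_two_pi _
  have hcos1 : ∀ (k : ℕ) , Real.cos (2 * Real.pi * (k+1) * (n+1)) = 1 := by
    intro k
    rw [show 2 * Real.pi * ((k:ℝ)+1) * (n+1) = (((k+1) * (n+1) : ℕ):ℝ) * (2*Real.pi) by push_cast; ring]
    exact Real.cos_nat_mul_two_pi _
  -- dominated convergence
  have hdom : HasSum (fun k : ℕ => ∫ x in (n:ℝ)..(n+1),
      f2 x * ((1 / ((k:ℝ)+1)^2 * Real.cos (2 * Real.pi * (k+1) * x) : ℝ):ℂ))
      (∫ x in (n:ℝ)..(n+1), f2 x * ((Real.pi^2 * ((x-n)^2 - (x-n) + 1/6) : ℝ):ℂ)) := by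
    refine intervalIntegral.hasSum_integral_of_dominated_convergence
      (fun k x => ‖f2 x‖ * (1 / ((k:ℝ)+1)^2)) ?_ ?_ ?_ ?_ ?_
    · intro k
      have : ContinuousOn (fun x:ℝ => f2 x * ((1 / ((k:ℝ)+1)^2 * Real.cos (2 * Real.pi * (k+1) * x) : ℝ):ℂ)) (Set.uIcc (n:ℝ) (n+1)) := by
        refine hf2.mul (Continuous.continuousOn (by fun_prop))
      exact (this.mono Set.uIoc_subset_uIcc).aestronglyMeasurable measurableSet_uIoc
    · intro k
      refine Filter.Eventually.of_forall fun x hx => ?_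
      rw [norm_mul, Complex.norm_real, Real.norm_eq_abs, abs_mul]
      gcongr
      have h1 : |1 / ((k:ℝ)+1)^2| = 1 / ((k:ℝ)+1)^2 := abs_of_nonneg (by positivity)
      rw [h1]
      exact mul_le_of_le_one_right (by positivity) (Real.abs_cos_le_one _)
    · exact Filter.Eventually.of_forall fun x hx => hz.summable.mul_left _
    · simp_rw [tsum_mul_left]
      exact (hf2.norm.mul continuousOn_const).intervalIntegrable
    · refine Filter.Eventually.of_forall fun x hx => ?_
      have := hcos x (huI ▸ Set.uIoc_subset_uIcc hx)
      exact (Complex.hasSum_ofReal.mpr this).mul_left _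
  -- integrate by parts
  have hP : (∫ x in (n:ℝ)..(n+1), f2 x * ((Real.pi^2 * ((x-n)^2 - (x-n) + 1/6) : ℝ):ℂ))
      = Real.pi^2 * ((f1 (n+1) - f1 n)/6 - (f (n+1) + f n) + 2 * ∫ x in (n:ℝ)..(n+1), f x) := by
    have e1 := intervalIntegral.integral_deriv_mul_eq_sub (a := (n:ℝ)) (b := n+1) (u := f1) (u' := f2)
      (v := fun x:ℝ => (((x-n)^2 - (x-n) + 1/6 : ℝ):ℂ)) (v' := fun x:ℝ => ((2*(x-n) - 1 : ℝ):ℂ)) hf1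
      (by
        intro x _
        apply HasDerivAt.ofReal_comp
        have h := (((hasDerivAt_id x).sub_const (n:ℝ)).pow 2).sub ((hasDerivAt_id x).sub_const (n:ℝ))
        have := h.add_const (1/6:ℝ)
        simpa using this)
      hf2.intervalIntegrable (Continuous.intervalIntegrable (by fun_prop) _ _)
    have e2 := intervalIntegral.integral_deriv_mul_eq_sub (a := (n:ℝ)) (b := n+1) (u := f) (u' := f1)
      (v := fun x:ℝ => ((2*(x-n) - 1 : ℝ):ℂ)) (v' := fun x:ℝ => ((2 : ℝ):ℂ)) hf
      (by
        intro x _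
        apply HasDerivAt.ofReal_comp
        have h := (((hasDerivAt_id x).sub_const (n:ℝ)).const_mul 2).sub_const (1:ℝ)
        simpa using h)
      hf1c.intervalIntegrable (Continuous.intervalIntegrable (by fun_prop) _ _)
    rw [intervalIntegral.integral_add] at e1 e2
    · rw [intervalIntegral.integral_mul_const] at e2
      have e3 : (∫ x in (n:ℝ)..(n+1), f2 x * ((Real.pi^2 * ((x-n)^2 - (x-n) + 1/6) : ℝ):ℂ)) =
        Real.pi^2 * ∫ x in (n:ℝ)..(n+1), f2 x * ((((x-n)^2 - (x-n) + 1/6) : ℝ):ℂ) := by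
        rw [← intervalIntegral.integral_const_mul]
        congr 1; ext x; push_cast; ring
      rw [e3]
      congr 1
      generalize (∫ x in (n:ℝ)..(n+1), f2 x * ((((x-n)^2 - (x-n) + 1/6) : ℝ):ℂ)) = I1 at e1 ⊢
      generalize (∫ x in (n:ℝ)..(n+1), f1 x * ((2*(x-n) - 1 : ℝ):ℂ)) = I2 at e1 e2
      push_cast at e1 e2 ⊢
      ring_nf at e1 e2 ⊢
      linear_combination e1 - e2
    · exact (hf1c.mul (Continuous.continuousOn (by fun_prop))).intervalIntegrable
    · exact (hfc.mul (Continuous.continuousOn (by fun_prop))).intervalIntegrable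
    · exact (hf2.mul (Continuous.continuousOn (by fun_prop))).intervalIntegrable
    · exact (hf1c.mul (Continuous.continuousOn (by fun_prop))).intervalIntegrable
  have hC : ∀ k : ℕ, (∫ x in (n:ℝ)..(n+1),
      f2 x * ((1 / ((k:ℝ)+1)^2 * Real.cos (2 * Real.pi * (k+1) * x) : ℝ):ℂ)) =
      ((1 / ((k:ℝ)+1)^2 : ℝ):ℂ) * (f1 (n+1) - f1 n) - 2 * Real.pi^2 *
        ∫ x in (n:ℝ)..(n+1), f x * (2 * Real.cos (2 * Real.pi * (k+1) * x) : ℝ) := by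
    intro k
    have e1 := intervalIntegral.integral_deriv_mul_eq_sub (a := (n:ℝ)) (b := n+1) (u := f1) (u' := f2)
      (v := fun x:ℝ => ((Real.cos (2 * Real.pi * (k+1) * x) : ℝ):ℂ))
      (v' := fun x:ℝ => ((-Real.sin (2 * Real.pi * (k+1) * x) * (2 * Real.pi * (k+1)) : ℝ):ℂ)) hf1
      (by
        intro x _
        apply HasDerivAt.ofReal_comp
        have h := ((hasDerivAt_id x).const_mul (2 * Real.pi * ((k:ℝ)+1))).cos
        simpa using h)
      hf2.intervalIntegrable (Continuous.intervalIntegrable (by fun_prop) _ _)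
    have e2 := intervalIntegral.integral_deriv_mul_eq_sub (a := (n:ℝ)) (b := n+1) (u := f) (u' := f1)
      (v := fun x:ℝ => ((-Real.sin (2 * Real.pi * (k+1) * x) * (2 * Real.pi * (k+1)) : ℝ):ℂ))
      (v' := fun x:ℝ => ((-(Real.cos (2 * Real.pi * (k+1) * x)* (2 * Real.pi * (k+1))) * (2 * Real.pi * (k+1)) : ℝ):ℂ)) hf
      (by
        intro x _
        apply HasDerivAt.ofReal_comp
        have h := (((hasDerivAt_id x).const_mul (2 * Real.pi * ((k:ℝ)+1))).sin.neg.mul_const (2 * Real.pi * ((k:ℝ)+1)))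
        simpa using h)
      hf1c.intervalIntegrable (Continuous.intervalIntegrable (by fun_prop) _ _)
    rw [intervalIntegral.integral_add] at e1 e2
    · simp only [hsin0, hsin1, hcos0, hcos1] at e1 e2
      have hk : ((k:ℂ)+1) ≠ 0 := by exact_mod_cast Nat.succ_ne_zero k
      have e3 : (∫ x in (n:ℝ)..(n+1), f2 x * ((1 / ((k:ℝ)+1)^2 * Real.cos (2 * Real.pi * (k+1) * x) : ℝ):ℂ)) =
        ((1 / ((k:ℝ)+1)^2 : ℝ):ℂ) * ∫ x in (n:ℝ)..(n+1), f2 x * ((Real.cos (2 * Real.pi * (k+1) * x) : ℝ):ℂ) := by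
        rw [← intervalIntegral.integral_const_mul]
        congr 1; ext x; push_cast; ring
      have e4 : (∫ x in (n:ℝ)..(n+1), f x * ((-(Real.cos (2 * Real.pi * (k+1) * x)* (2 * Real.pi * (k+1))) * (2 * Real.pi * (k+1)) : ℝ):ℂ))
        = (-2 * Real.pi^2 * (k+1)^2) * ∫ x in (n:ℝ)..(n+1), f x * (2 * Real.cos (2 * Real.pi * (k+1) * x) : ℝ) := by
        rw [← intervalIntegral.integral_const_mul]
        congr 1; ext x; push_cast; ring
      rw [e3]
      rw [e4] at e2
      set I := ∫ x in (n:ℝ)..(n+1), f x * (2 * Real.cos (2 * Real.pi * (k+1) * x) : ℝ)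
      generalize (∫ x in (n:ℝ)..(n+1), f2 x * ((Real.cos (2 * Real.pi * (k+1) * x) : ℝ):ℂ)) = I1 at e1 ⊢
      push_cast at e1 e2 ⊢
      field_simp
      linear_combination e1 - e2
    · exact (hf1c.mul (Continuous.continuousOn (by fun_prop))).intervalIntegrable
    · exact (hfc.mul (Continuous.continuousOn (by fun_prop))).intervalIntegrable
    · exact (hf2.mul (Continuous.continuousOn (by fun_prop))).intervalIntegrable
    · exact (hf1c.mul (Continuous.continuousOn (by fun_prop))).intervalIntegrable
  rw [hP] at hdom
  simp_rw [hC] at hdom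
  have hz' := (Complex.hasSum_ofReal.mpr hz).mul_right (f1 (n+1) - f1 n)
  have h := (hz'.sub hdom).mul_left (1/(2*(Real.pi:ℂ)^2))
  have g1 : (fun k : ℕ => ∫ x in (n:ℝ)..(n+1), f x * (2 * Real.cos (2 * Real.pi * (k+1) * x) : ℝ)) =
    (fun i:ℕ =>
      1 / (2 * (Real.pi:ℂ) ^ 2) *
        (((1 / ((i:ℝ) + 1) ^ 2 : ℝ):ℂ) * (f1 (↑n + 1) - f1 ↑n) -
          (((1 / ((i:ℝ) + 1) ^ 2 : ℝ):ℂ) * (f1 (↑n + 1) - f1 ↑n) -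
            2 * ↑Real.pi ^ 2 * ∫ (x : ℝ) in (n:ℝ)..↑n + 1, f x * ↑(2 * Real.cos (2 * Real.pi * (↑i + 1) * x))))) := by
    ext k
    generalize (∫ (x : ℝ) in (n:ℝ)..↑n + 1, f x * ((2 * Real.cos (2 * Real.pi * (k + 1) * x) : ℝ):ℂ)) = I
    field_simp
    ring
  rw [g1]
  refine hasSum_eq_aux h ?_
  push_cast
  field_simp
  ring


lemma seg_hasSum (A B : ℕ) (hAB : A ≤ B) (f f1 f2 : ℝ → ℂ)
    (hf : ∀ x ∈ Set.Icc (A:ℝ) B, HasDerivAt f (f1 x) x)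
    (hf1 : ∀ x ∈ Set.Icc (A:ℝ) B, HasDerivAt f1 (f2 x) x)
    (hf2 : ContinuousOn f2 (Set.Icc (A:ℝ) B)) :
    HasSum (fun k : ℕ => ∫ x in (A:ℝ)..B, f x * (2 * Real.cos (2 * Real.pi * (k+1) * x) : ℝ))
      (∑ n ∈ Finset.Icc A B, f n - (f A + f B) / 2 - ∫ x in (A:ℝ)..B, f x) := by
  induction B, hAB using Nat.le_induction with
  | base => 
    simp only [intervalIntegral.integral_same, Finset.Icc_self, Finset.sum_singleton]
    refine hasSum_eq_aux hasSum_zero ?_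
    ring
  | succ n hn ih =>
    have hn' : (A:ℝ) ≤ n := by exact_mod_cast hn
    have s1 : Set.Icc (A:ℝ) n ⊆ Set.Icc (A:ℝ) (n+1:ℕ) := Set.Icc_subset_Icc_right (by push_cast; linarith)
    have s2 : Set.Icc (n:ℝ) (n+1) ⊆ Set.Icc (A:ℝ) (n+1:ℕ) := Set.Icc_subset_Icc hn' (by push_cast; linarith)
    have h1 := ih (fun x hx => hf x (s1 hx)) (fun x hx => hf1 x (s1 hx)) (hf2.mono s1)
    have h2 := unit_hasSum n f f1 f2 (fun x hx => hf x (s2 hx)) (fun x hx => hf1 x (s2 hx)) (hf2.mono s2)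
    have hfc : ContinuousOn f (Set.Icc (A:ℝ) (n+1:ℕ)) := fun x hx => (hf x hx).continuousAt.continuousWithinAt
    have h := h1.add h2
    have i1 : ∀ g : ℝ → ℂ, Continuous g → (∫ x in (A:ℝ)..n, f x * g x) + (∫ x in (n:ℝ)..(n+1), f x * g x) =
        ∫ x in (A:ℝ)..(n+1:ℕ), f x * g x := by
      intro g hg
      push_cast
      apply intervalIntegral.integral_add_adjacent_intervals
      · apply ContinuousOn.intervalIntegrable
        rw [Set.uIcc_of_le hn']
        exact (hfc.mono s1).mul hg.continuousOn
      · apply ContinuousOn.intervalIntegrable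
        rw [Set.uIcc_of_le (by linarith)]
        exact (hfc.mono s2).mul hg.continuousOn
    have g1 : (fun k : ℕ => ∫ x in (A:ℝ)..(n+1:ℕ), f x * (2 * Real.cos (2 * Real.pi * (k+1) * x) : ℝ)) =
      (fun k : ℕ => (∫ x in (A:ℝ)..n, f x * (2 * Real.cos (2 * Real.pi * (k+1) * x) : ℝ)) +
        (∫ x in (n:ℝ)..(n+1), f x * (2 * Real.cos (2 * Real.pi * (k+1) * x) : ℝ))) := by
      ext k
      exact (i1 _ (by fun_prop)).symm
    rw [g1]
    refine hasSum_eq_aux h ?_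
    have i2 := i1 (fun _ => 1) continuous_const
    simp only [mul_one] at i2
    rw [← i2, Finset.sum_Icc_succ_top (by omega)]
    push_cast
    ring

lemma sum_Icc_int (g : ℤ → ℂ) (H : ℕ) :
    ∑ h ∈ Finset.Icc (-(H:ℤ)) H, g h = g 0 + ∑ k ∈ Finset.range H, (g (k+1) + g (-(k+1))) := by
  induction H with
  | zero => simp
  | succ n ih =>
    rw [Finset.sum_range_succ, ← add_assoc, ← ih]
    have : Finset.Icc (-((n+1:ℕ):ℤ)) ((n+1:ℕ):ℤ) = insert ((n:ℤ)+1) (insert (-((n:ℤ)+1)) (Finset.Icc (-(n:ℤ)) n)) := by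
      ext x; simp only [Finset.mem_Icc, Finset.mem_insert]; push_cast; omega
    rw [this, Finset.sum_insert, Finset.sum_insert]
    · ring
    · simp
    · simp only [Finset.mem_Icc, Finset.mem_insert]; omega

/-- Integration by parts for `q' = l q`. -/
lemma ibp_log (a b : ℝ) (hab : a ≤ b) (q l l' : ℝ → ℂ)
    (hq : ∀ x ∈ Set.Icc a b, HasDerivAt q (l x * q x) x)
    (hl : ∀ x ∈ Set.Icc a b, HasDerivAt l (l' x) x)
    (hl' : ContinuousOn l' (Set.Icc a b)) (h0 : ∀ x ∈ Set.Icc a b, l x ≠ 0) :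
    ∫ x in a..b, q x = q b / l b - q a / l a + ∫ x in a..b, q x * l' x / (l x)^2 := by
  have hu : Set.uIcc a b = Set.Icc a b := Set.uIcc_of_le hab
  have hqc : ContinuousOn q (Set.Icc a b) := fun x hx => (hq x hx).continuousAt.continuousWithinAt
  have hlc : ContinuousOn l (Set.Icc a b) := fun x hx => (hl x hx).continuousAt.continuousWithinAt
  have c1 : IntervalIntegrable q MeasureTheory.volume a b := ContinuousOn.intervalIntegrable (hu ▸ hqc)
  have c2 : IntervalIntegrable (fun x => q x * l' x / (l x)^2) MeasureTheory.volume a b := by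
    apply ContinuousOn.intervalIntegrable
    rw [hu]
    exact (hqc.mul hl').div (hlc.pow 2) (fun x hx => pow_ne_zero _ (h0 x hx))
  have := intervalIntegral.integral_eq_sub_of_hasDerivAt (f := fun x => q x / l x)
    (f' := fun x => q x - q x * l' x / (l x)^2) (a := a) (b := b) (by
      intro x hx
      rw [hu] at hx
      have h := (hq x hx).div (hl x hx) (h0 x hx)
      refine h.congr_deriv ?_
      have := h0 x hx
      field_simp) (c1.sub c2)
  rw [intervalIntegral.integral_sub c1 c2] at this
  rw [← this]; ring

lemma term_bound (A B : ℕ) (hAB : A ≤ B) (f μ μ' : ℝ → ℂ)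
    (hf : ∀ x ∈ Set.Icc (A:ℝ) B, HasDerivAt f (μ x * f x) x)
    (hμ : ∀ x ∈ Set.Icc (A:ℝ) B, HasDerivAt μ (μ' x) x)
    (hμ' : ContinuousOn μ' (Set.Icc (A:ℝ) B)) (k : ℕ)
    (him : ∀ x ∈ Set.Icc (A:ℝ) B, |(μ x).im| ≤ Real.pi * (k+1)) :
    ‖∫ x in (A:ℝ)..B, f x * (2 * Real.cos (2 * Real.pi * (k+1) * x) : ℝ)‖ ≤
      (‖μ A‖ * ‖f A‖ + ‖μ B‖ * ‖f B‖ + ∫ x in (A:ℝ)..B, ‖f x‖ * ‖μ' x‖) / ((k:ℝ)+1)^2 := by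
  have hAB' : (A:ℝ) ≤ B := by exact_mod_cast hAB
  have hu : Set.uIcc (A:ℝ) B = Set.Icc (A:ℝ) B := Set.uIcc_of_le hAB'
  have hfc : ContinuousOn f (Set.Icc (A:ℝ) B) := fun x hx => (hf x hx).continuousAt.continuousWithinAt
  have hk : (0:ℝ) < (k:ℝ)+1 := by positivity
  have hpi := Real.pi_gt_three
  have hpik : 0 < Real.pi * (k+1) := by positivity
  have hA : (A:ℝ) ∈ Set.Icc (A:ℝ) B := ⟨le_refl _, hAB'⟩
  have hB : (B:ℝ) ∈ Set.Icc (A:ℝ) B := ⟨hAB', le_refl _⟩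
  -- for a sign s
  have key : ∀ s : ℝ, |s| = 1 → (∀ x ∈ Set.Icc (A:ℝ) B, Real.pi * (k+1) ≤ ‖μ x + 2 * Real.pi * Complex.I * s * (k+1)‖) ∧
     (∫ x in (A:ℝ)..B, f x * Complex.exp (2 * Real.pi * Complex.I * s * (k+1) * x)) =
      f B * Complex.exp (2 * Real.pi * Complex.I * s * (k+1) * B) / (μ B + 2 * Real.pi * Complex.I * s * (k+1))
      - f A * Complex.exp (2 * Real.pi * Complex.I * s * (k+1) * A) / (μ A + 2 * Real.pi * Complex.I * s * (k+1)) +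
      ∫ x in (A:ℝ)..B, f x * Complex.exp (2 * Real.pi * Complex.I * s * (k+1) * x) * μ' x / (μ x + 2 * Real.pi * Complex.I * s * (k+1))^2 := by
    intro s hs
    have hge : ∀ x ∈ Set.Icc (A:ℝ) B, Real.pi * (k+1) ≤ ‖μ x + 2 * Real.pi * Complex.I * s * (k+1)‖ := by
      intro x hx
      refine le_trans ?_ (Complex.abs_im_le_norm _)
      have e : (μ x + 2 * Real.pi * Complex.I * s * (k+1)).im = (μ x).im + s * (2 * Real.pi * (k+1)) := by
        simp; ring
      rw [e]
      have h1 := him x hx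
      have h2 : |s * (2 * Real.pi * (k+1))| = 2 * (Real.pi * (k+1)) := by
        rw [abs_mul, hs, abs_of_pos (by positivity)]; ring
      have h3 := abs_sub_abs_le_abs_sub (s * (2 * Real.pi * (k+1))) (-(μ x).im)
      rw [abs_neg, h2] at h3
      have : s * (2 * Real.pi * (k+1)) - (-(μ x).im) = (μ x).im + s * (2 * Real.pi * (k+1)) := by ring
      rw [this] at h3
      linarith
    refine ⟨hge, ?_⟩
    have := ibp_log (A:ℝ) B hAB' (fun x => f x * Complex.exp (2 * Real.pi * Complex.I * s * (k+1) * x))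
      (fun x => μ x + 2 * Real.pi * Complex.I * s * (k+1)) μ' ?_ ?_ hμ' ?_
    · exact this
    · intro x hx
      have h1 : HasDerivAt (fun x:ℝ => Complex.exp (2 * Real.pi * Complex.I * s * (k+1) * x))
          (Complex.exp (2 * Real.pi * Complex.I * s * (k+1) * x) * (2 * Real.pi * Complex.I * s * (k+1))) x := by
        have h := ((Complex.ofRealCLM.hasDerivAt (x := x)).const_mul (2 * Real.pi * Complex.I * s * (k+1) : ℂ)).cexp
        simpa using h
      have h := (hf x hx).mul h1
      refine h.congr_deriv ?_
      ring
    · intro x hx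
      exact (hμ x hx).add_const _
    · intro x hx h0
      have := hge x hx
      rw [h0, norm_zero] at this
      linarith
  obtain ⟨gp, ep⟩ := key 1 (by simp)
  obtain ⟨gm, em⟩ := key (-1) (by simp)
  have hexp : ∀ (s : ℤ) (n : ℕ), Complex.exp (2 * Real.pi * Complex.I * s * (k+1) * n) = 1 := by
    intro s n
    rw [show (2 * Real.pi * Complex.I * s * (k+1) * n : ℂ) = ((s * (k+1) * n : ℤ):ℂ) * (2 * Real.pi * Complex.I) by
      push_cast; ring]
    exact Complex.exp_int_mul_two_pi_mul_I _
  have hsplit : (∫ x in (A:ℝ)..B, f x * (2 * Real.cos (2 * Real.pi * (k+1) * x) : ℝ)) =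
      (∫ x in (A:ℝ)..B, f x * Complex.exp (2 * Real.pi * Complex.I * (1:ℝ) * (k+1) * x)) +
      (∫ x in (A:ℝ)..B, f x * Complex.exp (2 * Real.pi * Complex.I * (-1:ℝ) * (k+1) * x)) := by
    rw [← intervalIntegral.integral_add]
    · congr 1; ext x
      rw [← mul_add]
      congr 1
      push_cast
      rw [Complex.two_cos]
      congr 2 <;> ring
    · apply ContinuousOn.intervalIntegrable; rw [hu]
      exact hfc.mul (Continuous.continuousOn (by fun_prop))
    · apply ContinuousOn.intervalIntegrable; rw [hu]
      exact hfc.mul (Continuous.continuousOn (by fun_prop))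
  have hIb : ∀ s : ℝ, |s| = 1 → (∀ x ∈ Set.Icc (A:ℝ) B, Real.pi * (k+1) ≤ ‖μ x + 2 * Real.pi * Complex.I * s * (k+1)‖) →
      ‖∫ x in (A:ℝ)..B, f x * Complex.exp (2 * Real.pi * Complex.I * s * (k+1) * x) * μ' x / (μ x + 2 * Real.pi * Complex.I * s * (k+1))^2‖
      ≤ (∫ x in (A:ℝ)..B, ‖f x‖ * ‖μ' x‖) / (Real.pi * (k+1))^2 := by
    intro s hs hge
    rw [← intervalIntegral.integral_div]
    refine intervalIntegral.norm_integral_le_of_norm_le hAB' ?_ ?_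
    · refine Filter.Eventually.of_forall fun x hx => ?_
      have hx' : x ∈ Set.Icc (A:ℝ) B := ⟨hx.1.le, hx.2⟩
      have he : ‖Complex.exp (2 * Real.pi * Complex.I * s * (k+1) * x)‖ = 1 := by
        rw [show (2 * Real.pi * Complex.I * s * (k+1) * x : ℂ) = ((2 * Real.pi * s * (k+1) * x : ℝ):ℂ) * Complex.I by
          push_cast; ring]
        exact Complex.norm_exp_ofReal_mul_I _
      rw [norm_div, norm_mul, norm_mul, he, mul_one, norm_pow]
      have := hge x hx'
      gcongr
    · apply ContinuousOn.intervalIntegrable; rw [hu]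
      exact (hfc.norm.mul hμ'.norm).div_const _
  have hbd : ∀ x ∈ Set.Icc (A:ℝ) B, ‖f x / (μ x + 2 * Real.pi * Complex.I * (1:ℝ) * (k+1)) +
      f x / (μ x + 2 * Real.pi * Complex.I * (-1:ℝ) * (k+1))‖ ≤ 2 * (‖μ x‖ * ‖f x‖) / (Real.pi * (k+1))^2 := by
    intro x hx
    have h1 := gp x hx
    have h2 := gm x hx
    have n1 : (μ x + 2 * Real.pi * Complex.I * (1:ℝ) * (k+1)) ≠ 0 := by
      intro h; rw [h, norm_zero] at h1; linarith
    have n2 : (μ x + 2 * Real.pi * Complex.I * (-1:ℝ) * (k+1)) ≠ 0 := by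
      intro h; rw [h, norm_zero] at h2; linarith
    have : f x / (μ x + 2 * Real.pi * Complex.I * (1:ℝ) * (k+1)) +
      f x / (μ x + 2 * Real.pi * Complex.I * (-1:ℝ) * (k+1)) =
      2 * (μ x * f x) / ((μ x + 2 * Real.pi * Complex.I * (1:ℝ) * (k+1)) * (μ x + 2 * Real.pi * Complex.I * (-1:ℝ) * (k+1))) := by
      rw [div_add_div _ _ n1 n2]
      congr 1
      push_cast; ring
    rw [this, norm_div, norm_mul, norm_mul, norm_mul, pow_two]
    simp only [Complex.norm_ofNat]
    gcongr
  have bp := hIb 1 (by simp) gp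
  have bm := hIb (-1) (by simp) gm
  have bA := hbd A hA
  have bB := hbd B hB
  have q1 := hexp 1 A
  have q2 := hexp 1 B
  have q3 := hexp (-1) A
  have q4 := hexp (-1) B
  rw [hsplit, ep, em]
  push_cast at q1 q2 q3 q4 bp bm bA bB ⊢
  rw [q1, q2, q3, q4]
  simp only [mul_one] at bA bB ⊢
  set X := ∫ x in (A:ℝ)..B, f x * Complex.exp (2 * Real.pi * Complex.I * (k+1) * x) * μ' x / (μ x + 2 * Real.pi * Complex.I * (k+1))^2
  set Y := ∫ x in (A:ℝ)..B, f x * Complex.exp (2 * Real.pi * Complex.I * -1 * (k+1) * x) * μ' x / (μ x + 2 * Real.pi * Complex.I * -1 * (k+1))^2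
  simp only [mul_one] at bp
  have hI0 : 0 ≤ ∫ x in (A:ℝ)..B, ‖f x‖ * ‖μ' x‖ :=
    intervalIntegral.integral_nonneg hAB' (fun x _ => by positivity)
  set I := ∫ x in (A:ℝ)..B, ‖f x‖ * ‖μ' x‖
  have hfin : ‖f B / (μ B + 2 * Real.pi * Complex.I * (k+1)) - f A / (μ A + 2 * Real.pi * Complex.I * (k+1)) + X +
     (f B / (μ B + 2 * Real.pi * Complex.I * -1 * (k+1)) - f A / (μ A + 2 * Real.pi * Complex.I * -1 * (k+1)) + Y)‖ ≤
     2 * (‖μ B‖ * ‖f B‖) / (Real.pi * (k+1))^2 + 2 * (‖μ A‖ * ‖f A‖) / (Real.pi * (k+1))^2 + I / (Real.pi * (k+1))^2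
       + I / (Real.pi * (k+1))^2 := by
    calc _ = ‖(f B / (μ B + 2 * Real.pi * Complex.I * (k+1)) + f B / (μ B + 2 * Real.pi * Complex.I * -1 * (k+1)))
       - (f A / (μ A + 2 * Real.pi * Complex.I * (k+1)) + f A / (μ A + 2 * Real.pi * Complex.I * -1 * (k+1))) + X + Y‖ := by
          congr 1; ring
      _ ≤ _ := by
          refine (norm_add_le _ _).trans (add_le_add ((norm_add_le _ _).trans (add_le_add ((norm_sub_le _ _).trans (add_le_add bB bA)) bp)) bm)
  refine hfin.trans ?_
  rw [← add_div, ← add_div, ← add_div, mul_pow, div_le_div_iff₀ (by positivity) (by positivity)]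
  have : 0 ≤ ‖μ A‖ * ‖f A‖ + ‖μ B‖ * ‖f B‖ + I := by positivity
  have h9 : (2:ℝ) ≤ Real.pi^2 := by nlinarith
  have := mul_le_mul_of_nonneg_right h9 this
  have := mul_le_mul_of_nonneg_right this (sq_nonneg ((k:ℝ)+1))
  linarith

theorem core (A B : ℕ) (hAB : A ≤ B) (f μ μ' : ℝ → ℂ)
    (hf : ∀ x ∈ Set.Icc (A:ℝ) B, HasDerivAt f (μ x * f x) x)
    (hμ : ∀ x ∈ Set.Icc (A:ℝ) B, HasDerivAt μ (μ' x) x)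
    (hμ' : ContinuousOn μ' (Set.Icc (A:ℝ) B)) (H : ℕ)
    (him : ∀ x ∈ Set.Icc (A:ℝ) B, |(μ x).im| ≤ Real.pi * (H+1)) (S : ℝ)
    (hS : ‖μ A‖ * ‖f A‖ + ‖μ B‖ * ‖f B‖ + (∫ x in (A:ℝ)..B, ‖f x‖ * ‖μ' x‖) ≤ S) :
    ‖∑ n ∈ Finset.Icc A B, f n - (f A + f B) / 2 -
      ∑ h ∈ Finset.Icc (-(H:ℤ)) H, ∫ x in (A:ℝ)..B, f x * Complex.exp (-(2 * Real.pi * Complex.I * h * x))‖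
      ≤ 2 * S / (H+1) := by
  have hAB' : (A:ℝ) ≤ B := by exact_mod_cast hAB
  have hu : Set.uIcc (A:ℝ) B = Set.Icc (A:ℝ) B := Set.uIcc_of_le hAB'
  have hfc : ContinuousOn f (Set.Icc (A:ℝ) B) := fun x hx => (hf x hx).continuousAt.continuousWithinAt
  have hμc : ContinuousOn μ (Set.Icc (A:ℝ) B) := fun x hx => (hμ x hx).continuousAt.continuousWithinAt
  have hS0 : 0 ≤ S := by
    have : 0 ≤ ∫ x in (A:ℝ)..B, ‖f x‖ * ‖μ' x‖ :=
      intervalIntegral.integral_nonneg hAB' (fun x _ => by positivity)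
    exact le_trans (by positivity) hS
  set T : ℕ → ℂ := fun k => ∫ x in (A:ℝ)..B, f x * (2 * Real.cos (2 * Real.pi * (k+1) * x) : ℝ) with hT
  have hsum : HasSum T (∑ n ∈ Finset.Icc A B, f n - (f A + f B) / 2 - ∫ x in (A:ℝ)..B, f x) := by
    refine seg_hasSum A B hAB f (fun x => μ x * f x) (fun x => μ' x * f x + μ x * (μ x * f x)) hf ?_ ?_
    · intro x hx; exact (hμ x hx).mul (hf x hx)
    · exact (hμ'.mul hfc).add (hμc.mul (hμc.mul hfc))
  have hb : ∀ k, H ≤ k → ‖T k‖ ≤ S / ((k:ℝ)+1)^2 := by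
    intro k hk
    have hk' : (H:ℝ) ≤ k := by exact_mod_cast hk
    refine (term_bound A B hAB f μ μ' hf hμ hμ' k (fun x hx => (him x hx).trans ?_)).trans ?_
    · have := Real.pi_pos; gcongr
    · gcongr
  have hpart : ∀ K, H ≤ K → ‖∑ k ∈ Finset.range K, T k - ∑ k ∈ Finset.range H, T k‖ ≤ 2 * S / (H+1) - 2 * S / (K+1) := by
    intro K hK
    induction K, hK using Nat.le_induction with
    | base => simp
    | succ n hn ih =>
      rw [Finset.sum_range_succ, add_sub_right_comm]
      refine (norm_add_le _ _).trans ((add_le_add ih (hb n hn)).trans ?_)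
      have e : S / ((n:ℝ)+1)^2 ≤ 2 * S / (n+1) - 2 * S / (n+1+1) := by
        rw [div_sub_div _ _ (by positivity) (by positivity), div_le_div_iff₀ (by positivity) (by positivity)]
        have h1 : (n:ℝ)+2 ≤ 2 * (n+1) := by
          have : (0:ℝ) ≤ n := by positivity
          linarith
        have h2 := mul_le_mul_of_nonneg_left h1 (by positivity : 0 ≤ S * ((n:ℝ)+1))
        nlinarith
      push_cast
      linarith
  have hlim := (hsum.tendsto_sum_nat.sub_const (∑ k ∈ Finset.range H, T k)).norm
  have hle := le_of_tendsto hlim (Filter.eventually_atTop.mpr ⟨H, fun K hK => (hpart K hK).trans (sub_le_self _ (by positivity))⟩)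
  refine le_trans (le_of_eq ?_) hle
  congr 1
  rw [sum_Icc_int]
  have i0 : (∫ x in (A:ℝ)..B, f x * Complex.exp (-(2 * Real.pi * Complex.I * (0:ℤ) * x))) = ∫ x in (A:ℝ)..B, f x := by
    simp
  have i1 : ∀ k : ℕ, (∫ x in (A:ℝ)..B, f x * Complex.exp (-(2 * Real.pi * Complex.I * ((k:ℤ)+1:ℤ) * x))) +
     (∫ x in (A:ℝ)..B, f x * Complex.exp (-(2 * Real.pi * Complex.I * (-((k:ℤ)+1):ℤ) * x))) = T k := by
    intro k
    rw [← intervalIntegral.integral_add]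
    · rw [hT]
      congr 1; ext x
      rw [← mul_add]
      congr 1
      push_cast
      rw [Complex.two_cos, add_comm]
      congr 2 <;> ring
    · apply ContinuousOn.intervalIntegrable; rw [hu]
      exact hfc.mul (Continuous.continuousOn (by fun_prop))
    · apply ContinuousOn.intervalIntegrable; rw [hu]
      exact hfc.mul (Continuous.continuousOn (by fun_prop))
  rw [i0, Finset.sum_congr rfl (fun k _ => i1 k)]
  ring

open Filter Topology



lemma log_add_one_aux (s : ℂ) (w : ℂ) (hs : 0 < s.re) (hw : 0 < (1 + w / s).re) :
    Complex.log (s + w) = Complex.log s + Complex.log (1 + w / s) := by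
  have hs0 : s ≠ 0 := by intro h; simp [h] at hs
  have h1 : |s.arg| < Real.pi / 2 := Complex.abs_arg_lt_pi_div_two_iff.mpr (Or.inl hs)
  have h2 : |(1 + w / s).arg| < Real.pi / 2 := Complex.abs_arg_lt_pi_div_two_iff.mpr (Or.inl hw)
  have hw0 : 1 + w / s ≠ 0 := by intro h; simp [h] at hw
  rw [abs_lt] at h1 h2
  rw [← Complex.log_mul hs0 hw0 ⟨by linarith [h1.1, h2.1], by linarith [h1.2, h2.2]⟩]
  congr 1
  field_simp

noncomputable def stG (s : ℂ) : ℂ := Complex.Gamma s * Complex.exp (s - (s - 1/2) * Complex.log s)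
noncomputable def stg (s : ℂ) : ℂ := (s + 1/2) * (Complex.log (s+1) - Complex.log s) - 1

lemma stG_step (s : ℂ) (hs : 0 < s.re) : stG s = stG (s+1) * Complex.exp (stg s) := by
  have hs0 : s ≠ 0 := by intro h; simp [h] at hs
  unfold stG stg
  rw [Complex.Gamma_add_one s hs0]
  have : Complex.exp (s - (s - 1/2) * Complex.log s) = s *
      (Complex.exp (s + 1 - (s + 1 - 1/2) * Complex.log (s+1)) * Complex.exp ((s + 1/2) * (Complex.log (s+1) - Complex.log s) - 1)) := by
    rw [show s * (Complex.exp (s + 1 - (s + 1 - 1/2) * Complex.log (s+1)) * Complex.exp ((s + 1/2) * (Complex.log (s+1) - Complex.log s) - 1)) = Complex.exp (Complex.log s) * (Complex.exp (s + 1 - (s + 1 - 1/2) * Complex.log (s+1)) * Complex.exp ((s + 1/2) * (Complex.log (s+1) - Complex.log s) - 1)) by rw [Complex.exp_log hs0]]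
    rw [← Complex.exp_add, ← Complex.exp_add]
    congr 1
    ring
  rw [this]; ring

lemma stg_bound (s : ℂ) (hs : 0 < s.re) (h2 : 2 ≤ ‖s‖) : ‖stg s‖ ≤ 2 / ‖s‖^2 := by
  have hs0 : s ≠ 0 := by intro h; simp [h] at hs
  have hz : ‖1/s‖ ≤ 1/2 := by
    rw [norm_div, norm_one]; gcongr
  have hre : 0 < (1 + 1/s).re := by
    have : |(1/s).re| ≤ 1/2 := (Complex.abs_re_le_norm _).trans hz
    rw [Complex.add_re, Complex.one_re]
    linarith [abs_le.mp this]
  have hlog := log_add_one_aux s 1 hs hre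
  have hT := Complex.norm_log_sub_logTaylor_le 2 (z := 1/s) (by linarith)
  have e : Complex.logTaylor (2+1) (1/s) = 1/s - (1/s)^2/2 := by
    simp [Complex.logTaylor, Finset.sum_range_succ]; ring
  rw [e] at hT
  set r := Complex.log (1 + 1/s) - (1/s - (1/s)^2/2) with hr
  have hst : stg s = -(1/s)^2/4 + (s + 1/2) * r := by
    unfold stg
    rw [hlog, hr]
    field_simp
    ring
  have hn : ‖1/s‖ = 1/‖s‖ := by rw [norm_div, norm_one]
  rw [hn] at hT hz
  have hsp : 0 < ‖s‖ := by linarith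
  have hr2 : ‖r‖ ≤ (1/‖s‖)^3 := by
    refine hT.trans ?_
    have : (1 - 1/‖s‖)⁻¹ ≤ 2 := by
      rw [inv_le_comm₀ (by linarith) (by norm_num)]; linarith
    have h3 : 0 ≤ (1/‖s‖)^(2+1) := by positivity
    have h4 := mul_le_mul_of_nonneg_left this h3
    have h5 : (1/‖s‖)^(2+1) * (1 - 1/‖s‖)⁻¹ / ((2:ℕ) + 1) ≤ (1/‖s‖)^(2+1) * 2 / ((2:ℕ)+1) := by gcongr
    refine h5.trans ?_
    push_cast
    have h6 : (1/‖s‖)^(2+1) = (1/‖s‖)^3 := by norm_num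
    rw [h6] at h3 ⊢
    linarith
  rw [hst]
  have hA : ‖-(1/s)^2/4‖ = (1/‖s‖)^2/4 := by
    rw [norm_div, norm_neg, norm_pow, hn]; norm_num
  have hB : ‖s + 1/2‖ ≤ ‖s‖ * (5/4) := by
    refine (norm_add_le _ _).trans ?_
    norm_num; linarith
  calc ‖-(1/s)^2/4 + (s + 1/2) * r‖ ≤ (1/‖s‖)^2/4 + (‖s‖ * (5/4)) * (1/‖s‖)^3 := by
        refine (norm_add_le _ _).trans ?_
        rw [hA, norm_mul]
        gcongr
    _ ≤ 2 / ‖s‖^2 := by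
        field_simp
        norm_num

lemma stG_iter (s : ℂ) (hs : 0 < s.re) (k : ℕ) :
    stG s = stG (s+k) * Complex.exp (∑ j ∈ Finset.range k, stg (s+j)) := by
  induction k with
  | zero => simp
  | succ n ih =>
    rw [ih, Finset.sum_range_succ, Complex.exp_add, stG_step (s+n) (by simp; positivity)]
    push_cast
    rw [add_assoc s n 1]
    ring

lemma Gamma_prod (s : ℂ) (hs : 0 < s.re) (k : ℕ) :
    Complex.Gamma (s + k) = Complex.Gamma s * ∏ j ∈ Finset.range k, (s + j) := by
  induction k with
  | zero => simp
  | succ n ih =>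
    rw [Finset.prod_range_succ, ← mul_assoc, ← ih]
    push_cast
    rw [← add_assoc, Complex.Gamma_add_one]
    · ring
    · intro h
      have := congrArg Complex.re h
      simp at this
      have : (0:ℝ) ≤ n := by positivity
      linarith

lemma stG_lim (s : ℂ) (hs : 0 < s.re) :
    Tendsto (fun n : ℕ => stG (s + (n+1:ℕ))) atTop (𝓝 ((Real.sqrt (2 * Real.pi) : ℝ):ℂ)) := by
  have hG : Complex.Gamma s ≠ 0 := Complex.Gamma_ne_zero_of_re_pos hs
  have l1 : Tendsto (fun n : ℕ => Complex.Gamma s / Complex.GammaSeq s n) atTop (𝓝 1) := by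
    have := (tendsto_const_nhds (x := Complex.Gamma s)).div (Complex.GammaSeq_tendsto_Gamma s) hG
    rwa [div_self hG] at this
  have l2 : Tendsto (fun n : ℕ => ((Stirling.stirlingSeq n : ℝ):ℂ)) atTop (𝓝 ((Real.sqrt Real.pi : ℝ):ℂ)) :=
    (Complex.continuous_ofReal.tendsto _).comp Stirling.tendsto_stirlingSeq_sqrt_pi
  have hdiv : Tendsto (fun n : ℕ => (s+1) / (n:ℂ)) atTop (𝓝 0) := by
    have := tendsto_const_div_atTop_nhds_zero_nat (𝕜 := ℂ) (s+1)
    exact this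
  have l3 : Tendsto (fun n : ℕ => Complex.log (1 + (s+1)/n)) atTop (𝓝 0) := by
    have h1 : Tendsto (fun n : ℕ => 1 + (s+1) / (n:ℂ)) atTop (𝓝 1) := by
      simpa using hdiv.const_add 1
    have := (continuousAt_clog (x := 1) (by simp)).tendsto.comp h1
    rw [Complex.log_one] at this
    exact this
  have l4 : Tendsto (fun n : ℕ => (n:ℂ) * Complex.log (1 + (s+1)/n)) atTop (𝓝 (s+1)) := by
    apply Complex.tendsto_nat_mul_log_one_add_of_tendsto
    refine tendsto_const_nhds.congr' ?_
    filter_upwards [eventually_ne_atTop 0] with n hn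
    have : (n:ℂ) ≠ 0 := by exact_mod_cast hn
    field_simp
  have l5 : Tendsto (fun n : ℕ => Complex.exp (s + 1 - ((n:ℂ) * Complex.log (1 + (s+1)/n) + (s + 1/2) * Complex.log (1 + (s+1)/n))))
      atTop (𝓝 1) := by
    have h1 := l4.add (l3.const_mul (s+1/2))
    have h2 := h1.const_sub (s+1)
    have h3 := h2.cexp
    simpa using h3
  have l6 := ((l1.mul l2).mul_const ((Real.sqrt 2 : ℝ):ℂ)).mul l5
  have e6 : (1:ℂ) * ((Real.sqrt Real.pi : ℝ):ℂ) * ((Real.sqrt 2:ℝ):ℂ) * 1 = ((Real.sqrt (2 * Real.pi) : ℝ):ℂ) := by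
    rw [Real.sqrt_mul (by norm_num)]; push_cast; ring
  rw [e6] at l6
  refine l6.congr' ?_
  have hev : ∀ᶠ n : ℕ in atTop, ‖(s+1)/(n:ℂ)‖ < 1 := by
    have := hdiv.norm
    rw [norm_zero] at this
    exact this.eventually (gt_mem_nhds one_pos)
  filter_upwards [eventually_ne_atTop 0, hev] with n hn hsn
  have hn0 : (n:ℂ) ≠ 0 := by exact_mod_cast hn
  have hnpos : (0:ℝ) < n := by positivity
  have hprod : ∏ j ∈ Finset.range (n+1), (s + j) ≠ 0 := by
    rw [Finset.prod_ne_zero_iff]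
    intro j _ h
    have := congrArg Complex.re h
    simp at this
    have : (0:ℝ) ≤ j := by positivity
    linarith
  have hGn : Complex.Gamma (s + (n+1:ℕ)) = Complex.Gamma s / Complex.GammaSeq s n * ((n:ℂ)^s * n.factorial) := by
    rw [Gamma_prod s hs, Complex.GammaSeq]
    have h1 : (n:ℂ)^s ≠ 0 := by simp [Complex.cpow_eq_zero_iff, hn0]
    have h2 : ((n.factorial : ℕ):ℂ) ≠ 0 := by exact_mod_cast n.factorial_ne_zero
    field_simp
  have hfac : ((n.factorial : ℕ) : ℂ) = ((Stirling.stirlingSeq n : ℝ):ℂ) * ((Real.sqrt 2 : ℝ):ℂ) *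
      Complex.exp ((1/2) * Complex.log n + n * Complex.log n - n) := by
    have hr : (n.factorial : ℝ) = Stirling.stirlingSeq n * Real.sqrt 2 * Real.exp ((1/2) * Real.log n + n * Real.log n - n) := by
      have hE : Real.exp ((1/2) * Real.log n + n * Real.log n - n) = Real.sqrt n * (n / Real.exp 1)^n := by
        rw [Real.exp_sub, Real.exp_add, Real.sqrt_eq_rpow, Real.rpow_def_of_pos hnpos, div_pow, ← Real.exp_nat_mul, Real.exp_nat_mul (Real.log n), Real.exp_log hnpos]
        rw [mul_one, mul_comm (1/2 : ℝ) (Real.log n)]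
        ring
      rw [hE, Stirling.stirlingSeq]
      push_cast
      rw [Real.sqrt_mul (by norm_num)]
      have : (n / Real.exp 1)^n ≠ 0 := by positivity
      have : Real.sqrt n ≠ 0 := by positivity
      field_simp
    rw [show ((n.factorial : ℕ) : ℂ) = ((n.factorial : ℝ):ℂ) by push_cast; rfl, hr]
    push_cast
    rfl
  have hlog : Complex.log (s + (n+1:ℕ)) = Complex.log n + Complex.log (1 + (s+1)/n) := by
    have := log_add_one_aux n (s+1) (by simpa using hnpos) (by
      have h1 : |((s+1)/(n:ℂ)).re| < 1 := (Complex.abs_re_le_norm _).trans_lt hsn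
      rw [Complex.add_re, Complex.one_re]
      linarith [(abs_lt.mp h1).1])
    rw [← this]
    congr 1
    push_cast; ring
  unfold stG
  rw [hGn, hfac, hlog, Complex.cpow_def_of_ne_zero hn0]
  set Q := Complex.log (1 + (s+1)/n)
  set W := Complex.log (n:ℂ)
  have : Complex.exp (s + 1 - (n * Q + (s + 1/2) * Q)) = Complex.exp (W * s) * Complex.exp (1/2 * W + n * W - n) *
     Complex.exp (s + (n+1:ℕ) - (s + (n+1:ℕ) - 1/2) * (W + Q)) := by
    rw [← Complex.exp_add, ← Complex.exp_add]
    congr 1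
    push_cast
    ring
  rw [this]
  ring

theorem stirling_complex (s : ℂ) (hs : 0 < s.re) (ht : 8 ≤ |s.im|) :
    ‖stG s / ((Real.sqrt (2 * Real.pi) : ℝ):ℂ) - 1‖ ≤ 16 / |s.im| := by
  set t := |s.im| with htdef
  have hnorm : ∀ j : ℕ, ((j:ℝ) + t)^2 / 2 ≤ ‖s + j‖^2 := by
    intro j
    rw [← Complex.normSq_eq_norm_sq, Complex.normSq_apply]
    simp only [Complex.add_re, Complex.natCast_re, Complex.add_im, Complex.natCast_im, add_zero]
    have : t^2 = s.im * s.im := by rw [htdef, sq_abs]; ring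
    nlinarith [sq_nonneg ((j:ℝ) - t), mul_nonneg hs.le (Nat.cast_nonneg (α := ℝ) j), sq_nonneg s.re]
  have hgb : ∀ j : ℕ, ‖stg (s+j)‖ ≤ 4 / (j + t - 1) - 4 / (j + 1 + t - 1) := by
    intro j
    have hj : (0:ℝ) ≤ j := by positivity
    have h1 := hnorm j
    have h2 : 2 ≤ ‖s + j‖ := by nlinarith [norm_nonneg (s+j)]
    refine (stg_bound (s+j) (by simp; positivity) h2).trans ?_
    have h3 : 2 / ‖s+j‖^2 ≤ 2 / (((j:ℝ) + t)^2 / 2) := by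
      apply div_le_div_of_nonneg_left (by norm_num) (by positivity) h1
    refine h3.trans ?_
    rw [div_sub_div _ _ (by linarith) (by linarith), div_le_div_iff₀ (by positivity) (by apply mul_pos <;> linarith)]
    nlinarith
  have hsum : ∀ k : ℕ, ‖∑ j ∈ Finset.range k, stg (s+j)‖ ≤ 8 / t := by
    intro k
    have : ‖∑ j ∈ Finset.range k, stg (s+j)‖ ≤ 4 / (t - 1) - 4 / (k + t - 1) := by
      induction k with
      | zero => simp
      | succ n ih =>
        rw [Finset.sum_range_succ]
        refine (norm_add_le _ _).trans ((add_le_add ih (hgb n)).trans ?_)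
        push_cast; linarith
    refine this.trans ?_
    have h1 : 0 ≤ 4 / ((k:ℝ) + t - 1) := by
      apply div_nonneg (by norm_num); have : (0:ℝ) ≤ k := by positivity
      linarith
    have h2 : 4 / (t-1) ≤ 8 / t := by
      rw [div_le_div_iff₀ (by linarith) (by linarith)]; linarith
    linarith
  have hsq : ((Real.sqrt (2 * Real.pi) : ℝ):ℂ) ≠ 0 := by
    have : Real.sqrt (2 * Real.pi) ≠ 0 := by positivity
    exact_mod_cast this
  have hl := ((tendsto_const_nhds (x := stG s)).div (stG_lim s hs) hsq).sub_const 1 |>.norm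
  refine le_of_tendsto hl ?_
  have hev := (stG_lim s hs).eventually_ne hsq
  filter_upwards [hev] with n hn
  have e : stG s / stG (s + (n+1:ℕ)) = Complex.exp (∑ j ∈ Finset.range (n+1), stg (s+j)) := by
    rw [div_eq_iff hn, mul_comm]
    exact stG_iter s hs (n+1)
  show ‖stG s / stG (s + (n+1:ℕ)) - 1‖ ≤ _
  rw [e]
  have hb := hsum (n+1)
  have h8 : 8 / t ≤ 1 := by rw [div_le_one (by linarith)]; exact ht
  refine (Complex.norm_exp_sub_one_le (hb.trans h8)).trans ?_
  calc _ ≤ 2 * (8 / t) := by gcongr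
    _ = 16 / t := by ring



lemma three_prod (u v z : ℂ) (r : ℝ) (hr : r ≤ 1) (hu : ‖u - 1‖ ≤ r) (hv : ‖v - 1‖ ≤ r)
    (hz : ‖z - 1‖ ≤ r) : ‖u * v * z - 1‖ ≤ 7 * r := by
  have h0 : 0 ≤ r := (norm_nonneg _).trans hu
  have e : u * v * z - 1 = (u-1)*(v-1)*(z-1) + (u-1)*(v-1) + (u-1)*(z-1) + (v-1)*(z-1) + (u-1)+(v-1)+(z-1) := by ring
  rw [e]
  have m2 : ∀ x y : ℂ, ‖x‖ ≤ r → ‖y‖ ≤ r → ‖x * y‖ ≤ r := by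
    intro x y hx hy
    rw [norm_mul]
    calc ‖x‖ * ‖y‖ ≤ r * 1 := mul_le_mul hx (hy.trans hr) (norm_nonneg _) h0
      _ = r := mul_one r
  have h1 := m2 _ _ hu hv
  have h2 := m2 _ _ hu hz
  have h3 := m2 _ _ hv hz
  have h4 := m2 _ _ h1 hz
  calc _ ≤ r + r + r + r + r + r + r := by
        refine norm_add_le_of_le (norm_add_le_of_le (norm_add_le_of_le (norm_add_le_of_le (norm_add_le_of_le (norm_add_le_of_le h4 h1) h2) h3) hu) hv) hz
    _ = 7 * r := by ring

/-- the functional-equation factor main term -/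
noncomputable def chiX (a t : ℝ) : ℂ :=
  Complex.exp (Complex.I * (Real.pi/4 : ℝ) + ((a:ℂ) - Complex.I * t - 1/2) * (Real.log (t / (2*Real.pi)) : ℝ) + Complex.I * t)

lemma log_w (a t : ℝ) (ha : 0 < a) (ht : 0 < t) :
    Complex.log ((a:ℂ) - Complex.I * t) = (Real.log t : ℝ) - Complex.I * (Real.pi/2 : ℝ) + Complex.log (1 + Complex.I * (a/t : ℝ)) := by
  have h1 : (a:ℂ) - Complex.I * t = (t:ℂ) * (-Complex.I * (1 + Complex.I * (a/t:ℝ))) := by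
    have : (t:ℂ) ≠ 0 := by exact_mod_cast ht.ne'
    push_cast
    field_simp
    ring_nf
    simp
  have hne : 1 + Complex.I * ((a/t:ℝ):ℂ) ≠ 0 := by
    intro h
    have := congrArg Complex.re h
    simp at this
  have hre : 0 < (1 + Complex.I * ((a/t:ℝ):ℂ)).re := by simp
  have h2 := abs_lt.mp (Complex.abs_arg_lt_pi_div_two_iff.mpr (Or.inl hre))
  rw [h1, Complex.log_ofReal_mul ht (mul_ne_zero (by simp) hne), Complex.log_mul (by simp) hne ?_, Complex.log_neg_I]
  · push_cast; ring
  · rw [Complex.arg_neg_I]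
    constructor <;> linarith [h2.1, h2.2, Real.pi_pos]

theorem chi_asymp (a : ℝ) (ha : 1 ≤ a) (t : ℝ) (ht : 16 + 6 * a^2 ≤ t) (w : ℂ) (hw : w = a - Complex.I * t) :
    ‖2 * (2 * (Real.pi:ℂ)) ^ (-w) * Complex.Gamma w * Complex.cos (Real.pi * w / 2) - chiX a t‖
      ≤ 7 * ((16 + 6 * a^2) / t) * ‖chiX a t‖ := by
  have ht0 : 0 < t := by nlinarith
  have hat : a ≤ t / 2 := by nlinarith
  have hw0 : w ≠ 0 := by
    intro h
    have := congrArg Complex.re (hw.symm.trans h)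
    simp at this; linarith
  have hwre : w.re = a := by rw [hw]; simp
  have hwim : w.im = -t := by rw [hw]; simp
  set ε : ℂ := (w - 1/2) * Complex.log (1 + Complex.I * (a/t : ℝ)) - a with hε
  set q : ℂ := ((Real.sqrt (2 * Real.pi) : ℝ):ℂ) with hq
  have hqv : q = Complex.exp (1/2 * (Real.log (2 * Real.pi):ℝ)) := by
    rw [hq, Real.sqrt_eq_rpow, Real.rpow_def_of_pos (by positivity)]
    push_cast
    congr 1; ring
  have hq0 : q ≠ 0 := by rw [hqv]; exact Complex.exp_ne_zero _
  have key : 2 * (2 * (Real.pi:ℂ)) ^ (-w) * Complex.Gamma w * Complex.cos (Real.pi * w / 2)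
      = chiX a t * ((stG w / q) * Complex.exp ε * (1 + Complex.exp (-(Complex.I * Real.pi * w)))) := by
    have hG : Complex.Gamma w = stG w * Complex.exp ((w - 1/2) * Complex.log w - w) := by
      unfold stG
      rw [mul_assoc, ← Complex.exp_add]
      simp
    have hcos : Complex.cos (Real.pi * w / 2) = Complex.exp (Complex.I * Real.pi * w / 2) * (1 + Complex.exp (-(Complex.I * Real.pi * w))) / 2 := by
      rw [Complex.cos, mul_add, ← Complex.exp_add]
      congr 1
      rw [mul_one]
      congr 1
      · congr 1; ring
      · congr 1; ring
    have hp : (2 * (Real.pi:ℂ)) ^ (-w) = Complex.exp (-(w * (Real.log (2 * Real.pi):ℝ))) := by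
      rw [Complex.cpow_def_of_ne_zero (by simp [Real.pi_ne_zero]), Complex.ofReal_log (by positivity)]
      congr 1; push_cast; ring
    rw [hG, hcos, hp]
    have hlog : Complex.log w = (Real.log t : ℝ) - Complex.I * (Real.pi/2 : ℝ) + Complex.log (1 + Complex.I * (a/t : ℝ)) := by
      rw [hw]; exact log_w a t (by linarith) ht0
    have hE : Complex.exp (-(w * (Real.log (2 * Real.pi):ℝ))) * Complex.exp ((w - 1/2) * Complex.log w - w) * Complex.exp (Complex.I * Real.pi * w / 2) * q
       = chiX a t * Complex.exp ε := by
      rw [hqv, chiX, ← Complex.exp_add, ← Complex.exp_add, ← Complex.exp_add, ← Complex.exp_add]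
      congr 1
      rw [hε, hlog, Real.log_div ht0.ne' (by positivity), hw]
      push_cast
      generalize Complex.log (1 + Complex.I * (a/t)) = Q
      generalize ((Real.log t:ℝ):ℂ) = l1
      generalize ((Real.log (2*Real.pi):ℝ):ℂ) = l2
      ring
    have : ∀ G e1 e2 e3 cc : ℂ, 2 * e1 * (G * e2) * (e3 * cc / 2) = (e1 * e2 * e3 * q) * (G / q * cc) := by
      intros; field_simp
    rw [this, hE]; ring
  rw [key, show ∀ x y : ℂ, x * y - x = (y - 1) * x by intros; ring, norm_mul]
  gcongr
  have hr1 : (16 + 6 * a^2) / t ≤ 1 := by rw [div_le_one ht0]; exact ht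
  apply three_prod _ _ _ _ hr1
  · refine (stirling_complex w (by rw [hwre]; linarith) (by rw [hwim, abs_neg, abs_of_pos ht0]; nlinarith)).trans ?_
    rw [hwim, abs_neg, abs_of_pos ht0]
    gcongr
    nlinarith
  · have hεb : ‖ε‖ ≤ 3 * a^2 / t := by
      set z : ℂ := Complex.I * (a/t:ℝ) with hz
      have hzn : ‖z‖ = a / t := by
        rw [hz, norm_mul, Complex.norm_I, one_mul, Complex.norm_real, Real.norm_of_nonneg (by positivity)]
      have hz2 : a / t ≤ 1/2 := by rw [div_le_iff₀ ht0]; linarith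
      have hR := Complex.norm_log_one_add_sub_self_le (z := z) (by rw [hzn]; linarith)
      rw [hzn] at hR
      set R := Complex.log (1 + z) - z with hRd
      have hR2 : ‖R‖ ≤ (a/t)^2 := by
        refine hR.trans ?_
        have : (1 - a/t)⁻¹ ≤ 2 := by
          rw [inv_le_comm₀ (by linarith) (by norm_num)]; linarith
        calc (a/t)^2 * (1 - a/t)⁻¹ / 2 ≤ (a/t)^2 * 2 / 2 := by gcongr
          _ = _ := by ring
      have he : ε = ((a - 1/2 : ℝ):ℂ) * z + (w - 1/2) * R := by
        rw [hε, hRd, hw]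
        have : -(Complex.I * t) * z = a := by
          have : (t:ℂ) ≠ 0 := by exact_mod_cast ht0.ne'
          rw [hz]; push_cast; field_simp; simp
        push_cast
        linear_combination this
      have hwn : ‖w - 1/2‖ ≤ a + t := by
        have : w - 1/2 = ((a - 1/2 : ℝ):ℂ) + (-(Complex.I * t)) := by rw [hw]; push_cast; ring
        rw [this]
        refine (norm_add_le _ _).trans ?_
        rw [Complex.norm_real, norm_neg, norm_mul, Complex.norm_I, Complex.norm_real, Real.norm_of_nonneg (by linarith), Real.norm_of_nonneg ht0.le]
        linarith
      rw [he]
      calc _ ≤ (a - 1/2) * (a/t) + (a + t) * (a/t)^2 := by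
            refine (norm_add_le _ _).trans ?_
            rw [norm_mul _ z, norm_mul _ R, hzn, Complex.norm_real, Real.norm_of_nonneg (by linarith)]
            gcongr
        _ ≤ a * (a / t) + (t/2 + t) * (a/t)^2 := by
            gcongr
            linarith
        _ ≤ 3 * a^2/t := by
            field_simp
            nlinarith
    have h1 : 3 * a^2 / t ≤ 1 := by rw [div_le_one ht0]; nlinarith
    refine (Complex.norm_exp_sub_one_le (hεb.trans h1)).trans ?_
    calc 2 * ‖ε‖ ≤ 2 * (3 * a^2/t) := by gcongr
      _ = 6 * a^2 / t := by ring
      _ ≤ _ := by gcongr; linarith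
  · rw [add_sub_cancel_left, Complex.norm_exp]
    have : (-(Complex.I * Real.pi * w)).re = - (Real.pi * t) := by
      rw [hw]; simp
    rw [this, Real.exp_neg]
    have h1 : t ≤ Real.exp (Real.pi * t) := by
      have := Real.add_one_le_exp (Real.pi * t)
      nlinarith [Real.pi_gt_three]
    calc (Real.exp (Real.pi * t))⁻¹ ≤ t⁻¹ := by gcongr
      _ = 1 / t := by rw [one_div]
      _ ≤ _ := by gcongr; nlinarith

lemma chiX_norm (a t : ℝ) (ht : 0 < t) : ‖chiX a t‖ = (t/(2*Real.pi))^(a - 1/2) := by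
  rw [chiX, Complex.norm_exp, Real.rpow_def_of_pos (by positivity)]
  congr 1
  simp
  ring

theorem zeta_chi (a : ℝ) (ha : 1 ≤ a) (t : ℝ) (ht : 16 + 6 * a^2 ≤ t) (w : ℂ) (hw : w = a - Complex.I * t) :
    ‖riemannZeta (1 - w) - chiX a t * riemannZeta w‖
      ≤ 7 * ((16 + 6 * a^2) / t) * (t/(2*Real.pi))^(a - 1/2) * ‖riemannZeta w‖ := by
  have ht0 : 0 < t := by nlinarith
  have hwim : w.im = -t := by rw [hw]; simp
  rw [riemannZeta_one_sub]
  · rw [← sub_mul, norm_mul, ← chiX_norm a t ht0]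
    gcongr
    exact chi_asymp a ha t ht w hw
  · intro n h
    have := congrArg Complex.im h
    rw [hwim] at this
    simp at this; linarith
  · intro h
    have := congrArg Complex.im h
    rw [hwim] at this
    simp at this; linarith



lemma norm_cpow_w (a t x : ℝ) (hx : 0 < x) : ‖(x:ℂ)^(-((a:ℂ) - Complex.I * t))‖ = x^(-a) := by
  rw [Complex.norm_cpow_eq_rpow_re_of_pos hx]
  congr 1
  simp

lemma norm_w_le (a t : ℝ) (ha : 0 < a) (ht : 0 < t) : ‖(a:ℂ) - Complex.I * t‖ ≤ a + t := by
  refine (norm_sub_le _ _).trans ?_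
  rw [Complex.norm_real, norm_mul, Complex.norm_I, Complex.norm_real, Real.norm_of_nonneg ha.le, Real.norm_of_nonneg ht.le, one_mul]

lemma hasDerivAt_cpow_w (w : ℂ) (x : ℝ) (hx : 0 < x) :
    HasDerivAt (fun y : ℝ => (y:ℂ)^(-w)) (-w / x * (x:ℂ)^(-w)) x := by
  have hx0 : (x:ℂ) ≠ 0 := by exact_mod_cast hx.ne'
  have h1 : HasDerivAt (fun z : ℂ => z^(-w)) ((-w) * (x:ℂ)^(-w-1) * 1) x :=
    (hasDerivAt_id (x:ℂ)).cpow_const (Or.inl (by simpa using hx))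
  refine h1.comp_ofReal.congr_deriv ?_
  rw [Complex.cpow_sub _ _ hx0, Complex.cpow_one]
  field_simp

theorem core_pow (a t : ℝ) (ha : 0 < a) (ht : 0 < t) (A B : ℕ) (hA : 1 ≤ A) (hAB : A ≤ B) (H : ℕ)
    (hH : t ≤ Real.pi * (H+1) * A) (w : ℂ) (hw : w = a - Complex.I * t) :
    ‖∑ n ∈ Finset.Icc A B, (n:ℂ)^(-w) - ((A:ℂ)^(-w) + (B:ℂ)^(-w)) / 2 -
      ∑ h ∈ Finset.Icc (-(H:ℤ)) H, ∫ x in (A:ℝ)..B, (x:ℂ)^(-w) * Complex.exp (-(2 * Real.pi * Complex.I * h * x))‖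
      ≤ 2 * (3 * (a + t) * (A:ℝ)^(-a-1)) / (H+1) := by
  have hA1 : (1:ℝ) ≤ A := by exact_mod_cast hA
  have hAB1 : (A:ℝ) ≤ B := by exact_mod_cast hAB
  have hpos : ∀ x ∈ Set.Icc (A:ℝ) B, 0 < x := fun x hx => by linarith [hx.1]
  have hwn : ‖w‖ ≤ a + t := by rw [hw]; exact norm_w_le a t ha ht
  have hnf : ∀ x : ℝ, 0 < x → ‖(x:ℂ)^(-w)‖ = x^(-a) := fun x hx => by rw [hw]; exact norm_cpow_w a t x hx
  have := core A B hAB (fun x : ℝ => (x:ℂ)^(-w)) (fun x : ℝ => -w / x) (fun x : ℝ => w / x^2) ?_ ?_ ?_ H ?_ (3 * (a + t) * (A:ℝ)^(-a-1)) ?_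
  · simpa using this
  · intro x hx
    exact hasDerivAt_cpow_w w x (hpos x hx)
  · intro x hx
    have hx0 : (x:ℂ) ≠ 0 := by exact_mod_cast (hpos x hx).ne'
    have h1 : HasDerivAt (fun z : ℂ => -w / z) ((0 * (x:ℂ) - (-w) * 1) / (x:ℂ)^2) x :=
      (hasDerivAt_const (x:ℂ) (-w)).div (hasDerivAt_id (x:ℂ)) hx0
    refine h1.comp_ofReal.congr_deriv ?_
    ring
  · apply ContinuousOn.div continuousOn_const (by fun_prop)
    intro x hx
    have hx0 : (x:ℂ) ≠ 0 := by exact_mod_cast (hpos x hx).ne'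
    exact pow_ne_zero 2 hx0
  · intro x hx
    have hx0 := hpos x hx
    have : (-w / (x:ℂ)).im = t / x := by
      rw [Complex.div_ofReal_im, hw]; simp
    rw [this, abs_of_pos (by positivity), div_le_iff₀ hx0]
    refine hH.trans ?_
    gcongr
    exact hx.1
  · have hc : ∀ x ∈ Set.Icc (A:ℝ) B, ‖-w/(x:ℂ)‖ * ‖(x:ℂ)^(-w)‖ ≤ (a+t) * (A:ℝ)^(-a-1) := by
      intro x hx
      have hx0 := hpos x hx
      rw [hnf x hx0, norm_div, norm_neg, Complex.norm_real, Real.norm_of_nonneg hx0.le]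
      have e : x^(-a-1) = x^(-a) / x := Real.rpow_sub_one hx0.ne' _
      calc ‖w‖ / x * x^(-a) = ‖w‖ * x^(-a-1) := by rw [e]; ring
        _ ≤ (a+t) * (A:ℝ)^(-a-1) := by
          gcongr ?_ * ?_
          exact Real.rpow_le_rpow_of_nonpos (by linarith) hx.1 (by linarith)
    have hi : (∫ x in (A:ℝ)..B, ‖(x:ℂ)^(-w)‖ * ‖w / (x:ℂ)^2‖) ≤ (a+t) * (A:ℝ)^(-a-1) := by
      have e1 : (∫ x in (A:ℝ)..B, ‖(x:ℂ)^(-w)‖ * ‖w / (x:ℂ)^2‖) = ∫ x in (A:ℝ)..B, ‖w‖ * x^(-a-2) := by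
        apply intervalIntegral.integral_congr
        intro x hx
        rw [Set.uIcc_of_le hAB1] at hx
        have hx0 := hpos x hx
        simp only
        rw [hnf x hx0, norm_div, norm_pow, Complex.norm_real, Real.norm_of_nonneg hx0.le, Real.rpow_sub hx0, Real.rpow_two]
        ring
      rw [e1, intervalIntegral.integral_const_mul, integral_rpow]
      · refine le_trans (mul_le_mul_of_nonneg_left ?_ (norm_nonneg w)) (mul_le_mul_of_nonneg_right hwn (by positivity))
        have e3 : -a-2+1 = -a-1 := by ring
        rw [e3, div_le_iff_of_neg (by linarith)]
        have h1 : 0 ≤ (B:ℝ)^(-a-1) := by positivity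
        have h2 : 0 ≤ (A:ℝ)^(-a-1) := by positivity
        nlinarith
      · right
        refine ⟨by linarith, ?_⟩
        rw [Set.uIcc_of_le hAB1]
        intro h; linarith [h.1]
    have h1 := hc A ⟨le_refl _, hAB1⟩
    have h2 := hc B ⟨hAB1, le_refl _⟩
    calc _ ≤ (a+t) * (A:ℝ)^(-a-1) + (a+t) * (A:ℝ)^(-a-1) + (a+t) * (A:ℝ)^(-a-1) := by
          refine add_le_add (add_le_add h1 h2) hi
      _ = _ := by ring

lemma zeta_tendsto (w : ℂ) (hw : 1 < w.re) :
    Tendsto (fun n : ℕ => ∑ m ∈ Finset.Icc 1 n, (m:ℂ)^(-w)) atTop (𝓝 (riemannZeta w)) := by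
  have hs : HasSum (fun n : ℕ => 1 / (n:ℂ)^w) (riemannZeta w) := by
    rw [zeta_eq_tsum_one_div_nat_cpow hw]
    exact (Complex.summable_one_div_nat_cpow.mpr hw).hasSum
  have := (hs.tendsto_sum_nat).comp (tendsto_add_atTop_nat 1)
  refine this.congr ?_
  intro n
  have hw0 : w ≠ 0 := by intro h; rw [h] at hw; norm_num at hw
  simp only [Function.comp]
  rw [Finset.range_eq_Ico, Finset.sum_eq_sum_Ico_succ_bot (by omega)]
  simp only [Nat.cast_zero, Complex.zero_cpow hw0, div_zero, zero_add]
  apply Finset.sum_congr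
  · ext; simp
  · intro m _; rw [Complex.cpow_neg, one_div]

lemma tendsto_cpow_neg_re (z : ℂ) (hz : z.re < 0) : Tendsto (fun n : ℕ => (n:ℂ)^z) atTop (𝓝 0) := by
  rw [tendsto_zero_iff_norm_tendsto_zero]
  have h := (tendsto_rpow_neg_atTop (y := -z.re) (by linarith)).comp tendsto_natCast_atTop_atTop
  refine h.congr' ?_
  filter_upwards [eventually_gt_atTop 0] with n hn
  simp only [Function.comp]
  rw [show (n:ℂ) = ((n:ℝ):ℂ) by simp, Complex.norm_cpow_eq_rpow_re_of_pos (by exact_mod_cast hn), neg_neg]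

lemma B1_aux (a t : ℝ) (ha : 1 < a) (ht : 0 < t) (X : ℕ) (hX : 1 ≤ X) (hH : t ≤ Real.pi * X)
    (w : ℂ) (hw : w = a - Complex.I * t) :
    ‖riemannZeta w - ∑ m ∈ Finset.Icc 1 X, (m:ℂ)^(-w) + (X:ℂ)^(-w)/2 - (X:ℂ)^(1-w)/(w-1)‖ ≤
      6 * (a + t) * (X:ℝ)^(-a-1) := by
  have hwre : w.re = a := by rw [hw]; simp
  have hw1 : w - 1 ≠ 0 := by
    intro h
    have := congrArg Complex.re h
    simp [hwre] at this; linarith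
  have hw1' : 1 - w ≠ 0 := by rw [← neg_sub]; exact neg_ne_zero.mpr hw1
  have l1 := zeta_tendsto w (by rw [hwre]; exact ha)
  have l2 := tendsto_cpow_neg_re (-w) (by simp [hwre]; linarith)
  have l3 := tendsto_cpow_neg_re (1-w) (by simp [hwre]; linarith)
  have lim := ((((l1.sub_const (∑ m ∈ Finset.Icc 1 X, (m:ℂ)^(-w))).add_const ((X:ℂ)^(-w))).sub ((l2.const_add ((X:ℂ)^(-w))).div_const 2)).sub
    ((l3.sub_const ((X:ℂ)^(1-w))).div_const (1-w))).norm
  have e : riemannZeta w - ∑ m ∈ Finset.Icc 1 X, (m:ℂ)^(-w) + (X:ℂ)^(-w)/2 - (X:ℂ)^(1-w)/(w-1) =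
    riemannZeta w - ∑ m ∈ Finset.Icc 1 X, (m:ℂ)^(-w) + (X:ℂ)^(-w) - ((X:ℂ)^(-w) + 0)/2 - (0 - (X:ℂ)^(1-w))/(1-w) := by
    rw [← neg_sub w 1, div_neg, zero_sub, neg_div, neg_neg]; ring
  rw [e]
  refine le_of_tendsto lim ?_
  filter_upwards [eventually_ge_atTop X] with B hB
  have hc := core_pow a t (by linarith) ht X B hX hB 0 (by simpa using hH) w hw
  have hX1 : (1:ℝ) ≤ X := by exact_mod_cast hX
  have hXB : (X:ℝ) ≤ B := by exact_mod_cast hB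
  have hint : (∫ x in (X:ℝ)..B, (x:ℂ)^(-w)) = ((B:ℂ)^(1-w) - (X:ℂ)^(1-w))/(1-w) := by
    rw [integral_cpow]
    · rw [neg_add_eq_sub]; simp
    · right
      refine ⟨fun h => hw1 ?_, ?_⟩
      · linear_combination -h
      · rw [Set.uIcc_of_le hXB]
        intro h; linarith [h.1]
  have hsum : ∑ n ∈ Finset.Icc X B, (n:ℂ)^(-w) = ∑ m ∈ Finset.Icc 1 B, (m:ℂ)^(-w) - ∑ m ∈ Finset.Icc 1 X, (m:ℂ)^(-w) + (X:ℂ)^(-w) := by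
    have h1 := Finset.sum_Ico_consecutive (fun n : ℕ => (n:ℂ)^(-w)) (m := 1) (n := X) (k := B+1) hX (by omega)
    have h2 := Finset.sum_Ico_succ_top hX (fun n : ℕ => (n:ℂ)^(-w))
    have i1 : ∀ p q : ℕ, Finset.Icc p q = Finset.Ico p (q+1) := by intro p q; ext; simp
    rw [i1, i1, i1, h2, ← h1]
    ring
  simp only [CharP.cast_eq_zero, neg_zero, Finset.Icc_self, Finset.sum_singleton, Int.cast_zero, mul_zero, zero_mul, Complex.exp_zero, mul_one, zero_add, div_one] at hc
  rw [hsum] at hc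
  have hc2 := hc
  rw [hint] at hc2
  refine hc2.trans (le_of_eq ?_)
  ring

theorem B1 (a t : ℝ) (ha : 1 ≤ a) (ht : 0 < t) (X : ℕ) (hX : 1 ≤ X) (hH : t ≤ Real.pi * X)
    (w : ℂ) (hw : w = a - Complex.I * t) :
    ‖riemannZeta w - ∑ m ∈ Finset.Icc 1 X, (m:ℂ)^(-w) + (X:ℂ)^(-w)/2 - (X:ℂ)^(1-w)/(w-1)‖ ≤
      6 * (a + t) * (X:ℝ)^(-a-1) := by
  rcases ha.lt_or_eq with h | h
  · exact B1_aux a t h ht X hX hH w hw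
  have hX0 : (X:ℂ) ≠ 0 := by exact_mod_cast (by omega : X ≠ 0)
  have hXr : (0:ℝ) < X := by exact_mod_cast hX
  have hw1 : w ≠ 1 := by
    intro h
    have := congrArg Complex.im (hw.symm.trans h)
    simp at this; linarith
  set W : ℝ → ℂ := fun b => b - Complex.I * t with hW
  have hWa : W a = w := by rw [hw]
  have cW : ContinuousAt W a := by rw [hW]; fun_prop
  have cz : ContinuousAt (fun b => riemannZeta (W b)) a := by
    have : ContinuousAt riemannZeta (W a) := by
      rw [hWa]; exact (differentiableAt_riemannZeta hw1).continuousAt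
    exact this.comp cW
  have cp : ∀ m : ℕ, m ≠ 0 → ContinuousAt (fun b => (m:ℂ)^(-W b)) a := by
    intro m hm
    exact cW.neg.const_cpow (Or.inl (by exact_mod_cast hm))
  have cs : ContinuousAt (fun b => ∑ m ∈ Finset.Icc 1 X, (m:ℂ)^(-W b)) a := by
    refine tendsto_finsetSum _ (fun m hm => cp m ?_)
    have := (Finset.mem_Icc.mp hm).1; omega
  have c4 : ContinuousAt (fun b => (X:ℂ)^(1-W b)/(W b-1)) a := by
    refine ((continuousAt_const.sub cW).const_cpow (Or.inl hX0)).div (cW.sub continuousAt_const) ?_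
    rw [hWa]; exact sub_ne_zero.mpr hw1
  have cL := (((cz.sub cs).add ((cp X (by omega)).div_const 2)).sub c4).norm
  have cR : ContinuousAt (fun b : ℝ => 6 * (b + t) * (X:ℝ)^(-b-1)) a := by
    have : ContinuousAt (fun b : ℝ => (X:ℝ)^(-b-1)) a :=
      ContinuousAt.rpow continuousAt_const (by fun_prop) (Or.inl hXr.ne')
    exact ContinuousAt.mul (by fun_prop) this
  have L1 := cL.tendsto.mono_left (nhdsWithin_le_nhds (s := Set.Ioi a))
  have L2 := cR.tendsto.mono_left (nhdsWithin_le_nhds (s := Set.Ioi a))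
  have := le_of_tendsto_of_tendsto L1 L2 (by
    filter_upwards [self_mem_nhdsWithin] with b hb
    exact B1_aux b t (by rw [h]; exact hb) ht X hX hH (W b) rfl)
  rw [← hWa]
  exact this



theorem sd_test (a t h r : ℝ) (ha : 0 < a) (ht : 0 < t) (hr : 0 < r) (A B : ℝ) (hA : 0 < A) (hAB : A ≤ B)
    (w : ℂ) (hw : w = a - Complex.I * t) :
    ‖∫ x in A..B, (x:ℂ)^(-w) * Complex.exp (-(2 * Real.pi * Complex.I * h * x))‖ ≤
      A^(-a) * (1/r + ((r^2*B^2/t+1)*(Real.pi/r) + a/(2*r*A)*(B-A))) := by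
  have hpos : ∀ x ∈ Set.Icc A B, 0 < x := fun x hx => by linarith [hx.1]
  set f : ℝ → ℂ := fun x => (x:ℂ)^(-w) * Complex.exp (-(2 * Real.pi * Complex.I * h * x)) with hf
  set p : ℝ → ℝ := fun x => t / x - 2 * Real.pi * h with hp
  set q : ℝ → ℝ := fun x => p x^2 + r^2 with hq
  have hq0 : ∀ x, 0 < q x := fun x => by simp only [hq]; positivity
  set k : ℝ → ℝ := fun x => p x / q x with hk
  set k' : ℝ → ℝ := fun x => (-t/x^2) * (r^2 - p x^2) / (q x)^2 with hk'
  set E : ℝ → ℂ := fun x => ((r^2 / q x : ℝ):ℂ) - Complex.I * ((a / x * k x : ℝ):ℂ) + Complex.I * ((k' x : ℝ):ℂ) with hE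
  have hnf : ∀ x ∈ Set.Icc A B, ‖f x‖ = x^(-a) := by
    intro x hx
    simp only [hf]
    rw [norm_mul, hw, norm_cpow_w a t x (hpos x hx), Complex.norm_exp]
    simp
  have hnf2 : ∀ x ∈ Set.Icc A B, ‖f x‖ ≤ A^(-a) := by
    intro x hx
    rw [hnf x hx]
    exact Real.rpow_le_rpow_of_nonpos hA hx.1 (by linarith)
  have hdf : ∀ x ∈ Set.Icc A B, HasDerivAt f ((-((a/x:ℝ):ℂ) + Complex.I * (p x:ℝ)) * f x) x := by
    intro x hx
    have hx0 : (x:ℂ) ≠ 0 := by exact_mod_cast (hpos x hx).ne'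
    have h1 := hasDerivAt_cpow_w w x (hpos x hx)
    have h2 : HasDerivAt (fun y : ℝ => Complex.exp (-(2 * Real.pi * Complex.I * h * y)))
        (Complex.exp (-(2 * Real.pi * Complex.I * h * x)) * (-(2 * Real.pi * Complex.I * h * 1))) x := by
      have : HasDerivAt (fun z : ℂ => Complex.exp (-(2 * Real.pi * Complex.I * h * z)))
        (Complex.exp (-(2 * Real.pi * Complex.I * h * x)) * (-(2 * Real.pi * Complex.I * h * 1))) (x:ℂ) :=
        (((hasDerivAt_id (x:ℂ)).const_mul (2 * Real.pi * Complex.I * h)).neg).cexp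
      exact this.comp_ofReal
    refine (h1.mul h2).congr_deriv ?_
    simp only [hf, hp]
    rw [hw]
    push_cast
    field_simp
    ring
  have hdp : ∀ x ∈ Set.Icc A B, HasDerivAt p (-t/x^2) x := by
    intro x hx
    have h1 : HasDerivAt (fun y : ℝ => t / y - 2 * Real.pi * h) ((0 * x - t * 1) / x^2) x :=
      ((hasDerivAt_const x t).div (hasDerivAt_id x) (hpos x hx).ne').sub_const _
    refine h1.congr_deriv ?_
    ring
  have hdq : ∀ x ∈ Set.Icc A B, HasDerivAt q (2 * p x * (-t/x^2)) x := by
    intro x hx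
    refine (((hdp x hx).pow 2).add_const (r^2)).congr_deriv ?_
    simp
  have hdk : ∀ x ∈ Set.Icc A B, HasDerivAt k (k' x) x := by
    intro x hx
    refine ((hdp x hx).div (hdq x hx) (hq0 x).ne').congr_deriv ?_
    simp only [hk']
    congr 1
    simp only [hq]
    ring
  have hdF : ∀ x ∈ Set.Icc A B, HasDerivAt (fun x => f x * (-Complex.I * (k x : ℝ))) (f x - f x * E x) x := by
    intro x hx
    have h1 := ((hdk x hx).ofReal_comp).const_mul (-Complex.I)
    refine ((hdf x hx).mul h1).congr_deriv ?_
    have hk2 : ((p x * k x : ℝ):ℂ) = ((1 - r^2 / q x : ℝ):ℂ) := by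
      congr 1
      simp only [hk]
      have := (hq0 x).ne'
      field_simp
      simp only [hq]
      ring
    push_cast at hk2
    simp only [hE]
    push_cast
    have hI := Complex.I_mul_I
    linear_combination (f x) * hk2 - (f x) * (p x) * (k x) * hI
  have hcp : ContinuousOn p (Set.Icc A B) := fun x hx => (hdp x hx).continuousAt.continuousWithinAt
  have hcq : ContinuousOn q (Set.Icc A B) := fun x hx => (hdq x hx).continuousAt.continuousWithinAt
  have hck : ContinuousOn k (Set.Icc A B) := fun x hx => (hdk x hx).continuousAt.continuousWithinAt
  have hcf : ContinuousOn f (Set.Icc A B) := fun x hx => (hdf x hx).continuousAt.continuousWithinAt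
  have hcid : ∀ x ∈ Set.Icc A B, x ≠ 0 := fun x hx => (hpos x hx).ne'
  have hct : ContinuousOn (fun x : ℝ => t / x^2 / q x) (Set.Icc A B) :=
    (ContinuousOn.div continuousOn_const (by fun_prop) (fun x hx => pow_ne_zero 2 (hcid x hx))).div hcq (fun x _ => (hq0 x).ne')
  have hck' : ContinuousOn k' (Set.Icc A B) := by
    refine ContinuousOn.div (ContinuousOn.mul ?_ ?_) (hcq.pow 2) (fun x _ => pow_ne_zero 2 (hq0 x).ne')
    · exact ContinuousOn.div continuousOn_const (by fun_prop) (fun x hx => pow_ne_zero 2 (hcid x hx))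
    · exact continuousOn_const.sub (hcp.pow 2)
  have hcE : ContinuousOn E (Set.Icc A B) := by
    have c1 : ContinuousOn (fun x => r^2 / q x) (Set.Icc A B) := continuousOn_const.div hcq (fun x _ => (hq0 x).ne')
    have c2 : ContinuousOn (fun x => a / x * k x) (Set.Icc A B) := (continuousOn_const.div continuousOn_id hcid).mul hck
    exact ((Complex.continuous_ofReal.comp_continuousOn c1).sub (continuousOn_const.mul (Complex.continuous_ofReal.comp_continuousOn c2))).add
      (continuousOn_const.mul (Complex.continuous_ofReal.comp_continuousOn hck'))
  have hkb : ∀ x, |k x| ≤ 1/(2*r) := by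
    intro x
    simp only [hk]
    rw [abs_div, abs_of_pos (hq0 x), div_le_div_iff₀ (hq0 x) (by positivity)]
    simp only [hq]
    rw [← sq_abs (p x)]
    nlinarith [sq_nonneg (|p x| - r)]
  have hii : ∀ {g : ℝ → ℂ}, ContinuousOn g (Set.Icc A B) → IntervalIntegrable g MeasureTheory.volume A B := by
    intro g hg
    apply ContinuousOn.intervalIntegrable
    rwa [Set.uIcc_of_le hAB]
  have hint := intervalIntegral.integral_eq_sub_of_hasDerivAt (a := A) (b := B) (f := fun x => f x * (-Complex.I * (k x : ℝ)))
    (f' := fun x => f x - f x * E x) (by rw [Set.uIcc_of_le hAB]; exact hdF) (hii (hcf.sub (hcf.mul hcE)))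
  have hcfE : ContinuousOn (fun x => f x * E x) (Set.Icc A B) := hcf.mul hcE
  rw [intervalIntegral.integral_sub (hii hcf) (hii hcfE)] at hint
  have hAm : A ∈ Set.Icc A B := ⟨le_refl _, hAB⟩
  have hBm : B ∈ Set.Icc A B := ⟨hAB, le_refl _⟩
  have hAa : 0 < A^(-a) := Real.rpow_pos_of_pos hA _
  have hend : ∀ x ∈ Set.Icc A B, ‖f x * (-Complex.I * (k x : ℝ))‖ ≤ A^(-a) * (1/(2*r)) := by
    intro x hx
    rw [norm_mul (f x), norm_mul (-Complex.I), norm_neg, Complex.norm_I, one_mul, Complex.norm_real, Real.norm_eq_abs]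
    exact mul_le_mul (hnf2 x hx) (hkb x) (abs_nonneg _) hAa.le
  set C1 : ℝ := r^2*B^2/t + 1 with hC1
  have hC10 : 0 < C1 := by positivity
  set g : ℝ → ℝ := fun x => A^(-a) * (C1 * (t / x^2 / q x) + a/(2*r*A)) with hg
  have hEb : ∀ x ∈ Set.Icc A B, ‖f x * E x‖ ≤ g x := by
    intro x hx
    have hx0 := hpos x hx
    rw [norm_mul]
    refine mul_le_mul (hnf2 x hx) ?_ (norm_nonneg _) hAa.le
    simp only [hE]
    have b1 : ‖((r^2 / q x : ℝ):ℂ)‖ ≤ r^2*B^2/t * (t / x^2 / q x) := by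
      rw [Complex.norm_real, Real.norm_of_nonneg (div_nonneg (by positivity) (hq0 x).le)]
      have : r^2*B^2/t * (t / x^2 / q x) = (r^2 / q x) * (B^2 / x^2) := by
        field_simp
      rw [this]
      refine le_mul_of_one_le_right (div_nonneg (by positivity) (hq0 x).le) ?_
      rw [one_le_div (by positivity)]
      exact pow_le_pow_left₀ hx0.le hx.2 2
    have b2 : ‖Complex.I * ((a / x * k x : ℝ):ℂ)‖ ≤ a/(2*r*A) := by
      rw [norm_mul, Complex.norm_I, one_mul, Complex.norm_real, Real.norm_eq_abs, abs_mul, abs_of_pos (by positivity)]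
      calc a / x * |k x| ≤ a / A * (1/(2*r)) := by
            gcongr
            · exact hx.1
            · exact hkb x
        _ = _ := by field_simp
    have b3 : ‖Complex.I * ((k' x : ℝ):ℂ)‖ ≤ t / x^2 / q x := by
      rw [norm_mul, Complex.norm_I, one_mul, Complex.norm_real, Real.norm_eq_abs]
      simp only [hk']
      rw [abs_div, abs_mul, abs_of_pos (pow_pos (hq0 x) 2), abs_div, abs_neg, abs_of_pos ht, abs_of_pos (pow_pos hx0 2), mul_div_assoc, div_eq_mul_one_div (t/x^2) (q x)]
      refine mul_le_mul_of_nonneg_left ?_ (by positivity)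
      rw [div_le_div_iff₀ (pow_pos (hq0 x) 2) (hq0 x), one_mul, sq (q x)]
      refine mul_le_mul_of_nonneg_right ?_ (hq0 x).le
      · simp only [hq]
        rw [abs_le]; constructor <;> nlinarith [sq_nonneg (p x), sq_nonneg r]
    calc _ ≤ r^2*B^2/t * (t / x^2 / q x) + a/(2*r*A) + t / x^2 / q x :=
          norm_add_le_of_le (norm_sub_le_of_le b1 b2) b3
      _ = _ := by rw [hC1]; ring
  have hcg : ContinuousOn g (Set.Icc A B) := continuousOn_const.mul ((continuousOn_const.mul hct).add continuousOn_const)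
  have hdG : ∀ x ∈ Set.Icc A B, HasDerivAt (fun x => A^(-a) * (C1 * (-(Real.arctan (p x / r)) / r) + a/(2*r*A) * x)) (g x) x := by
    intro x hx
    have h1 := (((((hdp x hx).div_const r).arctan).neg.div_const r).const_mul C1).add ((hasDerivAt_id x).const_mul (a/(2*r*A)))
    refine (h1.const_mul (A^(-a))).congr_deriv ?_
    simp only [hg]
    have e : q x = r^2 * (1 + (p x / r)^2) := by simp only [hq]; field_simp; ring
    have hx0 := hpos x hx
    have h3 : 0 < 1 + (p x / r)^2 := by positivity
    rw [e]
    generalize 1 + (p x / r)^2 = y at h3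
    field_simp
  have hIg : (∫ x in A..B, g x) ≤ A^(-a) * (C1 * (Real.pi / r) + a/(2*r*A)*(B-A)) := by
    rw [intervalIntegral.integral_eq_sub_of_hasDerivAt (f := fun x => A^(-a) * (C1 * (-(Real.arctan (p x / r)) / r) + a/(2*r*A) * x)) (by rw [Set.uIcc_of_le hAB]; exact hdG)
      (by apply ContinuousOn.intervalIntegrable; rwa [Set.uIcc_of_le hAB])]
    rw [← mul_sub]
    refine mul_le_mul_of_nonneg_left ?_ hAa.le
    have h1 := Real.arctan_lt_pi_div_two (p A / r)
    have h2 := Real.neg_pi_div_two_lt_arctan (p B / r)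
    have h3 : (Real.arctan (p A / r) - Real.arctan (p B / r)) / r ≤ Real.pi / r := by
      gcongr; linarith
    have h4 := mul_le_mul_of_nonneg_left h3 hC10.le
    have e : C1 * ((Real.arctan (p A / r) - Real.arctan (p B / r)) / r) = C1 * (-(Real.arctan (p B / r)) / r) - C1 * (-(Real.arctan (p A / r)) / r) := by ring
    linarith
  have hfE : ‖∫ x in A..B, f x * E x‖ ≤ A^(-a) * (C1 * (Real.pi / r) + a/(2*r*A)*(B-A)) := by
    refine (intervalIntegral.norm_integral_le_of_norm_le hAB ?_ ?_).trans hIg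
    · refine MeasureTheory.ae_of_all _ (fun x hx => hEb x ⟨hx.1.le, hx.2⟩)
    · apply ContinuousOn.intervalIntegrable; rwa [Set.uIcc_of_le hAB]
  have hfin : (∫ x in A..B, f x) = f B * (-Complex.I * (k B : ℝ)) - f A * (-Complex.I * (k A : ℝ)) + ∫ x in A..B, f x * E x := by
    rw [← hint]; ring
  rw [hfin]
  calc _ ≤ A^(-a) * (1/(2*r)) + A^(-a) * (1/(2*r)) + A^(-a) * (C1 * (Real.pi / r) + a/(2*r*A)*(B-A)) :=
        norm_add_le_of_le (norm_sub_le_of_le (hend B hBm) (hend A hAm)) hfE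
    _ = _ := by field_simp; ring



lemma B1_simple (a t : ℝ) (ha : 1 ≤ a) (ht : 0 < t) (X : ℕ) (hX : 1 ≤ X) (hH : t ≤ Real.pi * X)
    (w : ℂ) (hw : w = a - Complex.I * t) :
    ‖riemannZeta w - ∑ m ∈ Finset.Icc 1 X, (m:ℂ)^(-w)‖ ≤ (6 * (a + 4) + 1) / X + 1 / t := by
  have hX1 : (1:ℝ) ≤ X := by exact_mod_cast hX
  have hX0 : (0:ℝ) < X := by linarith
  have h1 := B1 a t ha ht X hX hH w hw
  have hXa : (X:ℝ)^(-a) ≤ 1 / X := by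
    rw [one_div, ← Real.rpow_neg_one]
    exact Real.rpow_le_rpow_of_exponent_le hX1 (by linarith)
  have hc : (X:ℂ) = ((X:ℝ):ℂ) := by simp
  have h2 : ‖(X:ℂ)^(-w)/2‖ ≤ (1/X)/2 := by
    rw [norm_div, hc, hw, norm_cpow_w a t X hX0]
    norm_num at hXa ⊢; linarith
  have h3 : ‖(X:ℂ)^(1-w)/(w-1)‖ ≤ 1 / t := by
    have hn : t ≤ ‖w - 1‖ := by
      have := Complex.abs_im_le_norm (w-1)
      have e : (w-1).im = -t := by rw [hw]; simp
      rwa [e, abs_neg, abs_of_pos ht] at this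
    rw [norm_div]
    refine div_le_div₀ (by norm_num) ?_ ht hn
    rw [hc, Complex.norm_cpow_eq_rpow_re_of_pos hX0]
    apply Real.rpow_le_one_of_one_le_of_nonpos hX1
    rw [hw]; simp; linarith
  have h4 : 6 * (a + t) * (X:ℝ)^(-a-1) ≤ 6 * (a + 4) / X := by
    rw [Real.rpow_sub_one hX0.ne']
    have : a + t ≤ (a + 4) * X := by nlinarith [Real.pi_lt_four]
    calc 6 * (a+t) * ((X:ℝ)^(-a)/X) ≤ 6 * ((a+4) * X) * ((1/X)/X) := by gcongr
      _ = _ := by field_simp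
  set Z := riemannZeta w - ∑ m ∈ Finset.Icc 1 X, (m:ℂ)^(-w)
  have e : Z = (Z + (X:ℂ)^(-w)/2 - (X:ℂ)^(1-w)/(w-1)) - (X:ℂ)^(-w)/2 + (X:ℂ)^(1-w)/(w-1) := by ring
  rw [e]
  calc _ ≤ 6 * (a + 4) / X + (1/X)/2 + 1/t := norm_add_le_of_le (norm_sub_le_of_le (h1.trans h4) h2) h3
    _ ≤ 6 * (a + 4) / X + (1/X) + 1/t := by
      have : 0 < 1/(X:ℝ) := by positivity
      linarith
    _ = _ := by ring

theorem trunc_pt (a d : ℝ) (ha : 1 ≤ a) (hd : 0 < d) : ∃ K > (0:ℝ), ∀ n M : ℕ, 1 ≤ n → n ≤ M → ∀ w : ℂ,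
    w = a - Complex.I * (2 * Real.pi * d * n : ℝ) →
    ‖riemannZeta w - ∑ m ∈ Finset.Icc 1 M, (m:ℂ)^(-w)‖ ≤ K * (1 / n + Real.sqrt n / M) := by
  set K1 : ℝ := (6 * (a + 4) + 1) + 1 / (2 * Real.pi * d) with hK1
  have hK10 : 0 < K1 := by positivity
  obtain ⟨H, hH⟩ := exists_nat_ge (2 * d)
  set P : ℝ := 1 + (((2*d+2)^2*(2*d)/(2*Real.pi*d) * (2*d)+1) * Real.pi + a/2*(2*d+1)) with hP
  have hP0 : 0 < P := by positivity
  set K2 : ℝ := 6 * (a + 2 * Real.pi * d) + 2 with hK2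
  have hK20 : 0 < K2 := by positivity
  -- basic bound
  have basic : ∀ n X : ℕ, 1 ≤ n → n ≤ X → 2 * d * n ≤ X → ∀ w : ℂ,
      w = a - Complex.I * (2 * Real.pi * d * n : ℝ) →
      ‖riemannZeta w - ∑ m ∈ Finset.Icc 1 X, (m:ℂ)^(-w)‖ ≤ K1 / n := by
    intro n X hn hnX hdn w hw
    have hn1 : (1:ℝ) ≤ n := by exact_mod_cast hn
    have hnX1 : (n:ℝ) ≤ X := by exact_mod_cast hnX
    refine (B1_simple a (2 * Real.pi * d * n) ha (by positivity) X (hn.trans hnX) ?_ w hw).trans ?_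
    · nlinarith [Real.pi_pos]
    · rw [hK1, add_div _ (1 / (2 * Real.pi * d))]
      apply add_le_add
      · gcongr
      · rw [div_div]
  refine ⟨K1 + K2 + (2*H+1) * P, by positivity, ?_⟩
  intro n M hn hnM w hw
  have hn1 : (1:ℝ) ≤ n := by exact_mod_cast hn
  have hnM1 : (n:ℝ) ≤ M := by exact_mod_cast hnM
  have hM0 : (0:ℝ) < M := by linarith
  have hn0 : (0:ℝ) < n := by linarith
  by_cases hc : 2 * d * n ≤ M
  · refine (basic n M hn hnM hc w hw).trans ?_
    have : 0 ≤ Real.sqrt n / M := by positivity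
    have h2 : 0 ≤ 1 / (n:ℝ) := by positivity
    rw [div_eq_mul_one_div]
    apply mul_le_mul
    · have : 0 ≤ K2 + (2*H+1) * P := by positivity
      linarith
    · linarith
    · exact h2
    · positivity
  push Not at hc
  obtain ⟨B, hB1, hB2⟩ : ∃ B : ℕ, 2 * d * n ≤ B ∧ (B:ℝ) < 2 * d * n + 1 :=
    ⟨⌈2*d*n⌉₊, Nat.le_ceil _, Nat.ceil_lt_add_one (by positivity)⟩
  have hMB : M ≤ B := by
    have : (M:ℝ) ≤ B := by linarith
    exact_mod_cast this
  have hMB1 : (M:ℝ) ≤ B := by exact_mod_cast hMB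
  have hb := basic n B hn (hnM.trans hMB) hB1 w hw
  have ht0 : 0 < 2 * Real.pi * d * n := by positivity
  have hcore := core_pow a (2 * Real.pi * d * n) (by linarith) ht0 M B (hn.trans hnM) hMB H (by
    calc 2 * Real.pi * d * n = Real.pi * (2 * d) * n := by ring
      _ ≤ Real.pi * (H+1) * M := by gcongr; linarith) w hw
  have hsum : ∑ m ∈ Finset.Icc M B, (m:ℂ)^(-w) = ∑ m ∈ Finset.Icc 1 B, (m:ℂ)^(-w) - ∑ m ∈ Finset.Icc 1 M, (m:ℂ)^(-w) + (M:ℂ)^(-w) := by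
    have h1 := Finset.sum_Ico_consecutive (fun n : ℕ => (n:ℂ)^(-w)) (m := 1) (n := M) (k := B+1) (hn.trans hnM) (by omega)
    have h2 := Finset.sum_Ico_succ_top (hn.trans hnM) (fun n : ℕ => (n:ℂ)^(-w))
    have i1 : ∀ p q : ℕ, Finset.Icc p q = Finset.Ico p (q+1) := by intro p q; ext; simp
    rw [i1, i1, i1, h2, ← h1]
    ring
  have hMa : (M:ℝ)^(-a) ≤ 1 / M := by
    rw [one_div, ← Real.rpow_neg_one]
    exact Real.rpow_le_rpow_of_exponent_le (by linarith) (by linarith)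
  have hnorm : ∀ j : ℕ, M ≤ j → ‖(j:ℂ)^(-w)‖ ≤ 1 / n := by
    intro j hj
    have hj1 : (M:ℝ) ≤ j := by exact_mod_cast hj
    rw [show (j:ℂ) = ((j:ℝ):ℂ) by simp, hw, norm_cpow_w a _ j (by linarith)]
    calc (j:ℝ)^(-a) ≤ (j:ℝ)^(-1:ℝ) := Real.rpow_le_rpow_of_exponent_le (by linarith) (by linarith)
      _ = 1 / j := by rw [Real.rpow_neg_one, one_div]
      _ ≤ 1 / n := by gcongr; linarith
  have hIb : ∀ h : ℤ, ‖∫ x in (M:ℝ)..B, (x:ℂ)^(-w) * Complex.exp (-(2 * Real.pi * Complex.I * h * x))‖ ≤ P * (Real.sqrt n / M) := by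
    intro h
    have hs0 : 0 < Real.sqrt n := Real.sqrt_pos.mpr hn0
    have := sd_test a (2 * Real.pi * d * n) h (1 / Real.sqrt n) (by linarith) ht0 (by positivity) M B hM0 hMB1 w hw
    simp only [Complex.ofReal_intCast] at this
    refine this.trans ?_
    have hBM : (B:ℝ) ≤ (2*d+2) * M := by nlinarith
    have hBn : (B:ℝ) ≤ (2*d+2) * (2*d) * n := by nlinarith
    have e1 : (1 / Real.sqrt n)^2 * (B:ℝ)^2 / (2 * Real.pi * d * n) ≤ (2*d+2)^2*(2*d)/(2*Real.pi*d) * (2*d) := by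
      rw [div_pow, Real.sq_sqrt hn0.le, one_pow]
      calc 1 / (n:ℝ) * (B:ℝ)^2 / (2 * Real.pi * d * n) ≤ 1 / (n:ℝ) * ((2*d+2) * (2*d) * n)^2 / (2 * Real.pi * d * n) := by gcongr
        _ = (2*d+2)^2*(2*d)/(2*Real.pi*d) * (2*d) := by field_simp
    have e2 : a / (2 * (1 / Real.sqrt n) * M) * ((B:ℝ) - M) ≤ Real.sqrt n * (a/2*(2*d+1)) := by
      calc a / (2 * (1 / Real.sqrt n) * M) * ((B:ℝ) - M) ≤ a / (2 * (1 / Real.sqrt n) * M) * ((2*d+1) * M) := by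
            gcongr; linarith
        _ = _ := by field_simp
    have e3 : ∀ y : ℝ, y / (1 / Real.sqrt n) = Real.sqrt n * y := by intro y; rw [div_div_eq_mul_div]; ring
    rw [e3, e3]
    calc _ ≤ (1 / M) * (Real.sqrt n * 1 + (((2*d+2)^2*(2*d)/(2*Real.pi*d) * (2*d) + 1) * (Real.sqrt n * Real.pi) + Real.sqrt n * (a/2*(2*d+1)))) := by
          gcongr
      _ = _ := by rw [hP]; ring
  have hIs : ‖∑ h ∈ Finset.Icc (-(H:ℤ)) H, ∫ x in (M:ℝ)..B, (x:ℂ)^(-w) * Complex.exp (-(2 * Real.pi * Complex.I * h * x))‖ ≤ (2*H+1) * (P * (Real.sqrt n / M)) := by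
    refine (norm_sum_le_of_le _ (fun h _ => hIb h)).trans (le_of_eq ?_)
    rw [Finset.sum_const, nsmul_eq_mul]
    congr 1
    have : (Finset.Icc (-(H:ℤ)) H).card = 2 * H + 1 := by simp; omega
    rw [this]; push_cast; ring
  have hcb : 2 * (3 * (a + 2 * Real.pi * d * n) * (M:ℝ)^(-a-1)) / (H+1) ≤ 6 * (a + 2 * Real.pi * d) * (1 / n) := by
    have h1 : a + 2 * Real.pi * d * n ≤ (a + 2 * Real.pi * d) * M := by
      have : 2 * Real.pi * d * n ≤ 2 * Real.pi * d * M := by gcongr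
      nlinarith
    have h2 : 0 ≤ 2 * (3 * (a + 2 * Real.pi * d * n) * (M:ℝ)^(-a-1)) := by positivity
    refine (div_le_self h2 (by linarith [Nat.cast_nonneg (α := ℝ) H])).trans ?_
    rw [Real.rpow_sub_one hM0.ne']
    calc 2 * (3 * (a + 2 * Real.pi * d * n) * ((M:ℝ)^(-a)/M)) ≤ 2 * (3 * ((a + 2 * Real.pi * d) * M) * ((1 / M)/M)) := by gcongr
      _ = 6 * (a + 2 * Real.pi * d) * (1 / M) := by field_simp; ring
      _ ≤ _ := by gcongr
  have hcore' := hcore.trans hcb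
  rw [hsum] at hcore'
  revert hcore' hIs
  generalize (∑ h ∈ Finset.Icc (-(H:ℤ)) H, ∫ x in (M:ℝ)..B, (x:ℂ)^(-w) * Complex.exp (-(2 * Real.pi * Complex.I * h * x))) = I
  intro hIs hcore'
  set SB := ∑ m ∈ Finset.Icc 1 B, (m:ℂ)^(-w)
  set SM := ∑ m ∈ Finset.Icc 1 M, (m:ℂ)^(-w)
  have e : riemannZeta w - SM = (riemannZeta w - SB) + (SB - SM + (M:ℂ)^(-w) - ((M:ℂ)^(-w) + (B:ℂ)^(-w))/2 - I) + I - ((M:ℂ)^(-w) - (B:ℂ)^(-w))/2 := by ring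
  have h5 : ‖((M:ℂ)^(-w) - (B:ℂ)^(-w))/2‖ ≤ 1 / n := by
    rw [norm_div]
    have := norm_sub_le_of_le (hnorm M (le_refl _)) (hnorm B hMB)
    norm_num at this ⊢
    linarith
  rw [e]
  have hu : 0 ≤ 1 / (n:ℝ) := by positivity
  have hv : 0 ≤ Real.sqrt n / M := by positivity
  have hHP : 0 ≤ (2*(H:ℝ)+1) * P := by positivity
  calc _ ≤ K1 / n + 6 * (a + 2 * Real.pi * d) * (1 / n) + (2*H+1) * (P * (Real.sqrt n / M)) + 1 / n :=
        norm_sub_le_of_le (norm_add_le_of_le (norm_add_le_of_le hb hcore') hIs) h5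
    _ ≤ (K1 + K2) * (1 / n) + ((2*H+1) * P) * (Real.sqrt n / M) := by
        rw [hK2, div_eq_mul_one_div K1]
        linarith
    _ ≤ _ := by
        have h1 : 0 ≤ ((2*H+1) * P) * (1 / (n:ℝ)) := by positivity
        have h2 : 0 ≤ (K1 + K2) * (Real.sqrt n / M) := by positivity
        linarith




noncomputable def fm (d θ : ℝ) (m : ℕ) (x : ℝ) : ℂ :=
  Complex.exp (2 * (Real.pi:ℂ) * Complex.I * ((Fm d θ m x : ℝ):ℂ)) / ((Real.sqrt x : ℝ):ℂ)

lemma fm_norm (d θ : ℝ) (m : ℕ) (x : ℝ) : ‖fm d θ m x‖ = 1 / Real.sqrt x := by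
  unfold fm
  rw [norm_div, Complex.norm_exp, Complex.norm_real, Real.norm_of_nonneg (Real.sqrt_nonneg x)]
  simp

noncomputable def pm (d θ : ℝ) (m : ℕ) (x : ℝ) : ℝ := d * (Real.log m - Real.log d - Real.log x) + θ

lemma Fm_eq (d θ : ℝ) (hd : 0 < d) (m : ℕ) (hm : 1 ≤ m) (x : ℝ) (hx : 0 < x) :
    Fm d θ m x = d * x * (1 + Real.log m - Real.log d - Real.log x) + θ * x := by
  have hm0 : (0:ℝ) < m := by exact_mod_cast hm
  unfold Fm
  rw [Real.log_div (by positivity) (by positivity), Real.log_mul (by positivity) hm0.ne', Real.log_mul hd.ne' hx.ne', Real.log_exp]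
  ring

lemma Fm_deriv (d θ : ℝ) (hd : 0 < d) (m : ℕ) (hm : 1 ≤ m) (x : ℝ) (hx : 0 < x) :
    HasDerivAt (Fm d θ m) (pm d θ m x) x := by
  have h1 : HasDerivAt (fun x : ℝ => d * x * (1 + Real.log m - Real.log d - Real.log x) + θ * x)
      ((d * 1) * (1 + Real.log m - Real.log d - Real.log x) + d * x * (-(x⁻¹)) + θ * 1) x :=
    (((hasDerivAt_id x).const_mul d).mul ((Real.hasDerivAt_log hx.ne').const_sub _)).add ((hasDerivAt_id x).const_mul θ)
  have h2 := h1.congr_of_eventuallyEq (f₁ := Fm d θ m) (by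
    filter_upwards [lt_mem_nhds hx] with y hy
    exact Fm_eq d θ hd m hm y hy)
  refine h2.congr_deriv ?_
  unfold pm
  field_simp
  ring

theorem poisson_m (d θ : ℝ) (hd : 0 < d) (m : ℕ) (hm : 1 ≤ m) (N : ℕ) (hN : 1 ≤ N) (P0 : ℝ)
    (hP : ∀ x ∈ Set.Icc (1:ℝ) N, |pm d θ m x| ≤ P0) (H : ℕ) (hH : 2 * P0 ≤ H + 1) :
    ‖∑ n ∈ Finset.Icc 1 N, fm d θ m n - (fm d θ m 1 + fm d θ m N) / 2 -
      ∑ h ∈ Finset.Icc (-(H:ℤ)) H, ∫ x in (1:ℝ)..N, fm d θ m x * Complex.exp (-(2 * Real.pi * Complex.I * h * x))‖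
      ≤ 2 * (4 * Real.pi * P0 + 4 * Real.pi * d + 3) / (H+1) := by
  have hN1 : (1:ℝ) ≤ N := by exact_mod_cast hN
  have hpos : ∀ x ∈ Set.Icc (1:ℝ) N, 0 < x := fun x hx => by linarith [hx.1]
  have hP00 : 0 ≤ P0 := (abs_nonneg _).trans (hP 1 ⟨le_refl _, hN1⟩)
  set μ : ℝ → ℂ := fun x => 2 * (Real.pi:ℂ) * Complex.I * (pm d θ m x : ℝ) - ((1/(2*x) : ℝ):ℂ) with hμ
  set μ' : ℝ → ℂ := fun x => 2 * (Real.pi:ℂ) * Complex.I * ((-d/x : ℝ):ℂ) + ((1/(2*x^2) : ℝ):ℂ) with hμ'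
  have hf : ∀ x ∈ Set.Icc (1:ℝ) N, HasDerivAt (fm d θ m) (μ x * fm d θ m x) x := by
    intro x hx
    have hx0 := hpos x hx
    have hs0 : Real.sqrt x ≠ 0 := (Real.sqrt_pos.mpr hx0).ne'
    have hsc : ((Real.sqrt x : ℝ):ℂ) ≠ 0 := by exact_mod_cast hs0
    have h1 := (((Fm_deriv d θ hd m hm x hx0).ofReal_comp).const_mul (2 * (Real.pi:ℂ) * Complex.I)).cexp
    have h2 := (Real.hasDerivAt_sqrt hx0.ne').ofReal_comp
    have h3 := h1.div h2 hsc
    refine HasDerivAt.congr_deriv (f := fm d θ m) h3 ?_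
    simp only [hμ, fm]
    have hxs : (x:ℂ) = ((Real.sqrt x : ℝ):ℂ)^2 := by
      rw [← Complex.ofReal_pow, Real.sq_sqrt hx0.le]
    push_cast
    rw [hxs]
    generalize Complex.exp (2 * (Real.pi:ℂ) * Complex.I * ((Fm d θ m x : ℝ):ℂ)) = E
    generalize ((Real.sqrt x : ℝ):ℂ) = s at hsc
    field_simp
  have hnμ : ∀ x ∈ Set.Icc (1:ℝ) N, ‖μ x‖ ≤ 2 * Real.pi * P0 + 1/2 := by
    intro x hx
    have hx0 := hpos x hx
    refine norm_sub_le_of_le ?_ ?_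
    · rw [norm_mul, norm_mul, norm_mul, Complex.norm_I, Complex.norm_real, Complex.norm_real, Real.norm_of_nonneg Real.pi_pos.le, Real.norm_eq_abs]
      norm_num
      gcongr
      exact hP x hx
    · rw [Complex.norm_real, Real.norm_of_nonneg (by positivity)]
      apply div_le_div_of_nonneg_left (by norm_num) (by norm_num)
      linarith [hx.1]
  have hnf : ∀ x ∈ Set.Icc (1:ℝ) N, ‖fm d θ m x‖ ≤ 1 := by
    intro x hx
    rw [fm_norm, div_le_one (Real.sqrt_pos.mpr (hpos x hx))]
    exact Real.one_le_sqrt.mpr hx.1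
  have hm1 : (1:ℝ) ∈ Set.Icc (1:ℝ) N := ⟨le_refl _, hN1⟩
  have hmN : (N:ℝ) ∈ Set.Icc (1:ℝ) N := ⟨hN1, le_refl _⟩
  have hcμ' : ContinuousOn μ' (Set.Icc (1:ℝ) N) := by
    have c1 : ContinuousOn (fun x : ℝ => -d/x) (Set.Icc (1:ℝ) N) :=
      continuousOn_const.div continuousOn_id (fun x hx => (hpos x hx).ne')
    have c2 : ContinuousOn (fun x : ℝ => 1/(2*x^2)) (Set.Icc (1:ℝ) N) :=
      continuousOn_const.div (by fun_prop) (fun x hx => by have := hpos x hx; positivity)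
    exact (continuousOn_const.mul (Complex.continuous_ofReal.comp_continuousOn c1)).add (Complex.continuous_ofReal.comp_continuousOn c2)
  have hcf : ContinuousOn (fm d θ m) (Set.Icc (1:ℝ) N) := fun x hx => (hf x hx).continuousAt.continuousWithinAt
  have hcast : ((1:ℕ):ℝ) = 1 := Nat.cast_one
  have := core 1 N hN (fm d θ m) μ μ' (by rw [hcast]; exact hf) ?_ (by rw [hcast]; exact hcμ') H ?_ (4 * Real.pi * P0 + 4 * Real.pi * d + 3) ?_
  · rw [hcast] at this
    exact this
  · rw [hcast]
    intro x hx
    have hx0 := hpos x hx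
    have h1 : HasDerivAt (pm d θ m) (-d/x) x := by
      refine ((((Real.hasDerivAt_log hx0.ne').const_sub (Real.log m - Real.log d)).const_mul d).add_const θ).congr_deriv ?_
      ring
    have h2 : HasDerivAt (fun x : ℝ => 1/(2*x)) (-(1/(2*x^2))) x := by
      have : HasDerivAt (fun x : ℝ => 1/(2*x)) ((0 * (2*x) - 1 * (2*1))/(2*x)^2) x :=
        (hasDerivAt_const x (1:ℝ)).div ((hasDerivAt_id x).const_mul 2) (by positivity)
      refine this.congr_deriv ?_
      field_simp
      ring
    refine ((h1.ofReal_comp.const_mul (2 * (Real.pi:ℂ) * Complex.I)).sub h2.ofReal_comp).congr_deriv ?_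
    simp only [hμ']
    push_cast
    ring
  · rw [hcast]
    intro x hx
    have e : (μ x).im = 2 * Real.pi * pm d θ m x := by
      simp only [hμ]
      rw [Complex.sub_im, Complex.ofReal_im, sub_zero]
      simp
    rw [e, abs_mul, abs_of_pos (by positivity)]
    have := hP x hx
    nlinarith [Real.pi_pos]
  · rw [hcast]
    have t1 : ‖μ 1‖ * ‖fm d θ m 1‖ ≤ (2 * Real.pi * P0 + 1/2) * 1 :=
      mul_le_mul (hnμ 1 hm1) (hnf 1 hm1) (norm_nonneg _) (by positivity)
    have t2 : ‖μ N‖ * ‖fm d θ m N‖ ≤ (2 * Real.pi * P0 + 1/2) * 1 :=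
      mul_le_mul (hnμ N hmN) (hnf N hmN) (norm_nonneg _) (by positivity)
    have hnot : (0:ℝ) ∉ Set.uIcc (1:ℝ) N := by
      rw [Set.uIcc_of_le hN1]; intro h; linarith [h.1]
    have t3 : (∫ x in (1:ℝ)..N, ‖fm d θ m x‖ * ‖μ' x‖) ≤ (2 * Real.pi * d + 1) * 2 := by
      have hle : (∫ x in (1:ℝ)..N, ‖fm d θ m x‖ * ‖μ' x‖) ≤ ∫ x in (1:ℝ)..N, (2 * Real.pi * d + 1) * x^(-3/2:ℝ) := by
        apply intervalIntegral.integral_mono_on hN1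
        · apply ContinuousOn.intervalIntegrable
          rw [Set.uIcc_of_le hN1]
          exact hcf.norm.mul hcμ'.norm
        · apply IntervalIntegrable.const_mul
          exact intervalIntegral.intervalIntegrable_rpow (Or.inr hnot)
        · intro x hx
          have hx0 := hpos x hx
          have hb : ‖μ' x‖ ≤ (2 * Real.pi * d + 1) * x⁻¹ := by
            have : ‖μ' x‖ ≤ 2 * Real.pi * (d / x) + 1/(2*x^2) := by
              refine norm_add_le_of_le (le_of_eq ?_) (le_of_eq ?_)
              · rw [norm_mul, norm_mul, norm_mul, Complex.norm_I, Complex.norm_real, Complex.norm_real, Real.norm_of_nonneg Real.pi_pos.le, Real.norm_eq_abs, neg_div, abs_neg, abs_of_pos (by positivity)]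
                norm_num
              · rw [Complex.norm_real, Real.norm_of_nonneg (by positivity)]
            refine this.trans ?_
            have : 1/(2*x^2) ≤ 1 / x := by
              apply div_le_div_of_nonneg_left (by norm_num) hx0
              nlinarith [hx.1]
            calc _ ≤ 2 * Real.pi * (d / x) + 1 / x := by gcongr
              _ = _ := by field_simp
          rw [fm_norm]
          have e : x^(-3/2:ℝ) = 1 / Real.sqrt x * x⁻¹ := by
            rw [Real.sqrt_eq_rpow, one_div, ← Real.rpow_neg hx0.le, ← Real.rpow_neg_one x, ← Real.rpow_add hx0]
            norm_num
          rw [e]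
          calc _ ≤ 1 / Real.sqrt x * ((2 * Real.pi * d + 1) * x⁻¹) := by gcongr
            _ = _ := by ring
      refine hle.trans ?_
      rw [intervalIntegral.integral_const_mul, integral_rpow (Or.inr ⟨by norm_num, hnot⟩)]
      refine mul_le_mul_of_nonneg_left ?_ (by positivity)
      have : 0 ≤ (N:ℝ)^(-3/2+1:ℝ) := by positivity
      rw [Real.one_rpow, div_le_iff_of_neg (by norm_num)]
      norm_num at this ⊢
      linarith
    linarith



/-- `w_n = 1 - s_n` -/
noncomputable def wn (a d : ℝ) (n : ℕ) : ℂ := a - Complex.I * (2 * Real.pi * d * n : ℝ)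

lemma harm_le (n : ℕ) : ∑ m ∈ Finset.Icc 1 n, 1 / (m:ℝ) ≤ 1 + Real.log n := by
  have := harmonic_le_one_add_log n
  rw [harmonic_eq_sum_Icc] at this
  push_cast at this
  simpa [one_div] using this

lemma pow_sum_le (a : ℝ) (ha : 1 ≤ a) (n : ℕ) : ∑ m ∈ Finset.Icc 1 n, 1 / (m:ℝ)^a ≤ 1 + Real.log n := by
  refine le_trans (Finset.sum_le_sum ?_) (harm_le n)
  intro m hm
  have hm1 : (1:ℝ) ≤ m := by exact_mod_cast (Finset.mem_Icc.mp hm).1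
  apply div_le_div_of_nonneg_left (by norm_num) (by linarith)
  calc (m:ℝ) = (m:ℝ)^(1:ℝ) := (Real.rpow_one _).symm
    _ ≤ _ := Real.rpow_le_rpow_of_exponent_le hm1 ha

lemma norm_npow (a d : ℝ) (n m : ℕ) (hm : 1 ≤ m) : ‖(m:ℂ)^(-(wn a d n))‖ = 1 / (m:ℝ)^a := by
  have hm0 : (0:ℝ) < m := by exact_mod_cast hm
  rw [show (m:ℂ) = ((m:ℝ):ℂ) by simp, wn, norm_cpow_w a _ m hm0, Real.rpow_neg hm0.le, one_div]

lemma T_norm (a d : ℝ) (ha : 1 ≤ a) (n M : ℕ) : ‖∑ m ∈ Finset.Icc 1 M, (m:ℂ)^(-(wn a d n))‖ ≤ 1 + Real.log M := by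
  refine (norm_sum_le _ _).trans (le_trans (le_of_eq ?_) (pow_sum_le a ha M))
  apply Finset.sum_congr rfl
  intro m hm
  exact norm_npow a d n m (Finset.mem_Icc.mp hm).1

lemma zeta_wn (a d : ℝ) (ha : 1 ≤ a) (hd : 0 < d) : ∃ K > (0:ℝ), ∀ n : ℕ, 1 ≤ n →
    ‖riemannZeta (wn a d n)‖ ≤ K * (n:ℝ)^(1/4:ℝ) := by
  obtain ⟨K, hK, h⟩ := trunc_pt a d ha hd
  refine ⟨2 * K + 5, by positivity, ?_⟩
  intro n hn
  have hn1 : (1:ℝ) ≤ n := by exact_mod_cast hn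
  have h1 := h n n hn le_rfl _ rfl
  rw [← wn] at h1
  have h2 := T_norm a d ha n n
  have e : riemannZeta (wn a d n) = (riemannZeta (wn a d n) - ∑ m ∈ Finset.Icc 1 n, (m:ℂ)^(-(wn a d n))) + ∑ m ∈ Finset.Icc 1 n, (m:ℂ)^(-(wn a d n)) := by ring
  rw [e]
  refine (norm_add_le_of_le h1 h2).trans ?_
  have h3 : Real.log n ≤ (n:ℝ)^(1/4:ℝ) / (1/4) := Real.log_le_rpow_div (by linarith) (by norm_num)
  have h4 : 1 ≤ (n:ℝ)^(1/4:ℝ) := Real.one_le_rpow hn1 (by norm_num)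
  have h5 : 1 / (n:ℝ) ≤ 1 := by rw [div_le_one (by linarith)]; exact hn1
  have h6 : Real.sqrt n / n ≤ 1 := by
    rw [div_le_one (by linarith), Real.sqrt_le_left (by linarith)]
    nlinarith
  have h7 : K * (1 / (n:ℝ) + Real.sqrt n / n) ≤ K * 2 := by gcongr; linarith
  nlinarith

lemma summ_A (a d : ℝ) (ha : 1 ≤ a) (hd : 0 < d) : Summable (fun n : ℕ =>
    ‖riemannZeta (1 - wn a d n) - chiX a (2 * Real.pi * d * n) * riemannZeta (wn a d n)‖ / (n:ℝ)^a) := by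
  obtain ⟨K, hK, hz⟩ := zeta_wn a d ha hd
  have hs : Summable (fun n : ℕ => (n:ℝ)^(-(5/4):ℝ)) := Real.summable_nat_rpow.mpr (by norm_num)
  refine summable_of_isBigO_nat hs ?_
  set T0 : ℝ := 16 + 6 * a^2 with hT0
  have hT00 : 0 < T0 := by positivity
  obtain ⟨n0, hn0⟩ := exists_nat_ge (T0 / (2 * Real.pi * d))
  refine Asymptotics.IsBigO.of_bound (7 * (T0 / (2 * Real.pi * d)) * d^(a-1/2) * K) ?_
  filter_upwards [eventually_ge_atTop (max n0 1)] with n hn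
  have hn1 : 1 ≤ n := (le_max_right _ _).trans hn
  have hn2 : n0 ≤ n := (le_max_left _ _).trans hn
  have hn1r : (1:ℝ) ≤ n := by exact_mod_cast hn1
  have hnp : (0:ℝ) < n := by linarith
  have hn2r : (n0:ℝ) ≤ n := by exact_mod_cast hn2
  have ht : T0 ≤ 2 * Real.pi * d * n := by
    have := hn0.trans hn2r
    rw [div_le_iff₀ (by positivity)] at this
    linarith
  have h1 := zeta_chi a ha (2 * Real.pi * d * n) ht (wn a d n) rfl
  rw [Real.norm_of_nonneg (by positivity), Real.norm_of_nonneg (by positivity), div_le_iff₀ (by positivity)]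
  refine h1.trans ?_
  have e1 : 2 * Real.pi * d * n / (2 * Real.pi) = d * n := by field_simp
  rw [e1, Real.mul_rpow hd.le hnp.le, ← hT0]
  calc _ ≤ 7 * (T0 / (2 * Real.pi * d * n)) * (d^(a-1/2) * (n:ℝ)^(a-1/2)) * (K * (n:ℝ)^(1/4:ℝ)) := by
        gcongr
        exact hz n hn1
    _ = 7 * (T0 / (2 * Real.pi * d)) * d^(a-1/2) * K * ((n:ℝ)^(-1:ℝ) * (n:ℝ)^(a-1/2) * (n:ℝ)^(1/4:ℝ)) := by
        rw [Real.rpow_neg_one]; field_simp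
    _ = 7 * (T0 / (2 * Real.pi * d)) * d^(a-1/2) * K * ((n:ℝ)^(-(5/4):ℝ) * (n:ℝ)^a) := by
        rw [← Real.rpow_add hnp, ← Real.rpow_add hnp, ← Real.rpow_add hnp]
        congr 2
        ring
    _ ≤ _ := le_of_eq (by ring)

lemma sum_B (a d : ℝ) (ha : 1 ≤ a) (hd : 0 < d) : ∃ K > (0:ℝ), ∀ M N : ℕ, 1 ≤ N → N ≤ M →
    ∑ n ∈ Finset.Icc 1 N, 1 / Real.sqrt n * ‖riemannZeta (wn a d n) - ∑ m ∈ Finset.Icc 1 M, (m:ℂ)^(-(wn a d n))‖ ≤ K := by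
  obtain ⟨K, hK, h⟩ := trunc_pt a d ha hd
  have hs : Summable (fun n : ℕ => (n:ℝ)^(-(3/2):ℝ)) := Real.summable_nat_rpow.mpr (by norm_num)
  have hts : 0 ≤ ∑' n : ℕ, (n:ℝ)^(-(3/2):ℝ) := tsum_nonneg (fun n => by positivity)
  refine ⟨K * ((∑' n : ℕ, (n:ℝ)^(-(3/2):ℝ)) + 1), by positivity, ?_⟩
  intro M N hN hNM
  have hN1 : (1:ℝ) ≤ N := by exact_mod_cast hN
  have hNM1 : (N:ℝ) ≤ M := by exact_mod_cast hNM
  calc _ ≤ ∑ n ∈ Finset.Icc 1 N, K * ((n:ℝ)^(-(3/2):ℝ) + 1 / M) := by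
        apply Finset.sum_le_sum
        intro n hn
        obtain ⟨hn1, hn2⟩ := Finset.mem_Icc.mp hn
        have hn1r : (1:ℝ) ≤ n := by exact_mod_cast hn1
        have hnp : (0:ℝ) < n := by linarith
        have h1 := h n M hn1 (hn2.trans hNM) _ rfl
        rw [← wn] at h1
        have hs0 : 0 < Real.sqrt n := Real.sqrt_pos.mpr hnp
        calc _ ≤ 1 / Real.sqrt n * (K * (1 / n + Real.sqrt n / M)) := by gcongr
          _ = K * (1 / Real.sqrt n * (1 / n) + 1 / M) := by field_simp
          _ = _ := by
            congr 2
            rw [Real.sqrt_eq_rpow, one_div ((n:ℝ)^(1/2:ℝ)), one_div (n:ℝ), ← Real.rpow_neg hnp.le, ← Real.rpow_neg_one (n:ℝ), ← Real.rpow_add hnp]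
            norm_num
    _ = K * (∑ n ∈ Finset.Icc 1 N, (n:ℝ)^(-(3/2):ℝ) + N * (1 / M)) := by
        rw [← Finset.mul_sum, Finset.sum_add_distrib, Finset.sum_const, nsmul_eq_mul]
        simp
    _ ≤ _ := by
        gcongr
        · exact hs.sum_le_tsum _ (fun n _ => by positivity)
        · rw [mul_one_div, div_le_one (by linarith)]; exact hNM1

lemma ident_C (a d θ : ℝ) (hd : 0 < d) (m n : ℕ) (hm : 1 ≤ m) (hn : 1 ≤ n) :
    chiX a (2 * Real.pi * d * n) * (m:ℂ)^(-(wn a d n)) * Complex.exp (2 * (Real.pi : ℂ) * Complex.I * (θ : ℂ) * (n : ℂ)) / (((n:ℝ)^a : ℝ):ℂ)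
     = (Complex.exp (2 * (Real.pi : ℂ) * Complex.I / 8) * (((d ^ (a - 1/2) : ℝ)) : ℂ)) * ((1 / (((m : ℝ) ^ a : ℝ) : ℂ)) * fm d θ m n) := by
  have hm0 : (0:ℝ) < m := by exact_mod_cast hm
  have hn0 : (0:ℝ) < n := by exact_mod_cast hn
  have e1 : 2 * Real.pi * d * n / (2 * Real.pi) = d * n := by field_simp
  unfold chiX fm
  rw [e1, Fm_eq d θ hd m hm n hn0, Real.log_mul hd.ne' hn0.ne', Real.rpow_def_of_pos hn0, Real.rpow_def_of_pos hd, Real.rpow_def_of_pos hm0,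
    Real.sqrt_eq_rpow, Real.rpow_def_of_pos hn0, show (m:ℂ) = ((m:ℝ):ℂ) by simp, Complex.cpow_def_of_ne_zero (by exact_mod_cast hm0.ne'), ← Complex.ofReal_log hm0.le]
  unfold wn
  rw [Complex.ofReal_exp, Complex.ofReal_exp, Complex.ofReal_exp, Complex.ofReal_exp, div_eq_mul_inv, div_eq_mul_inv _ (Complex.exp ((Real.log n * (1/2) : ℝ):ℂ)), one_div (Complex.exp _),
    ← Complex.exp_neg, ← Complex.exp_neg, ← Complex.exp_neg]
  simp only [← Complex.exp_add]
  congr 1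
  push_cast
  ring

lemma norm_C (a d : ℝ) (hd : 0 < d) (n : ℕ) (hn : 1 ≤ n) :
    ‖chiX a (2 * Real.pi * d * n)‖ / (n:ℝ)^a = d^(a-1/2) * (1 / Real.sqrt n) := by
  have hn0 : (0:ℝ) < n := by exact_mod_cast hn
  have e1 : 2 * Real.pi * d * n / (2 * Real.pi) = d * n := by field_simp
  rw [chiX_norm _ _ (by positivity), e1, Real.mul_rpow hd.le hn0.le, Real.rpow_sub hn0, Real.sqrt_eq_rpow]
  have : 0 < (n:ℝ)^a := by positivity
  field_simp



/-- analytic bound for the Poisson error: `(∑ m^{-a}) L^{-α}` -/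
lemma Q_bound (σ α C2 : ℝ) (hσ : σ ≤ 0) (hα0 : 0 < α) (hα1 : α ≤ 1) (hC2 : 1 < C2) :
    ∃ K > (0:ℝ), ∀ M N : ℕ, 2 ≤ M → 1 ≤ N → (M:ℝ) ≤ C2 * N →
      (∑ m ∈ Finset.Icc 1 M, 1 / (m:ℝ)^(1-σ)) * (Real.log ((M:ℝ) * N))^(-α) ≤
        K * (1 + (if σ = 0 then 1 else 0) * (Real.log N) ^ (1 - α)) := by
  have hl2 : 0 < Real.log 2 := Real.log_pos (by norm_num)
  have hlC : 0 < Real.log C2 := Real.log_pos hC2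
  have hL : ∀ M N : ℕ, 2 ≤ M → 1 ≤ N → Real.log 2 ≤ Real.log ((M:ℝ) * N) := by
    intro M N hM hN
    have hM2 : (2:ℝ) ≤ M := by exact_mod_cast hM
    have hN1 : (1:ℝ) ≤ N := by exact_mod_cast hN
    exact Real.log_le_log (by norm_num) (by nlinarith)
  by_cases h0 : σ = 0
  · set B : ℝ := (Real.log C2)^(1-α) + 2^(1-α) with hB
    have hB0 : 0 < B := by positivity
    refine ⟨(1 / Real.log 2 + 1) * B, by positivity, ?_⟩
    intro M N hM hN hMN
    have hM2 : (2:ℝ) ≤ M := by exact_mod_cast hM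
    have hN1 : (1:ℝ) ≤ N := by exact_mod_cast hN
    have hL1 := hL M N hM hN
    set L := Real.log ((M:ℝ) * N) with hLd
    have hL0 : 0 < L := by linarith
    have hLs : L = Real.log M + Real.log N := Real.log_mul (by linarith) (by linarith)
    have hlN : 0 ≤ Real.log N := Real.log_nonneg hN1
    have hlM : Real.log M ≤ Real.log C2 + Real.log N := by
      rw [← Real.log_mul (by linarith) (by linarith)]
      exact Real.log_le_log (by linarith) hMN
    have h1 := pow_sum_le (1-σ) (by linarith) M
    have h2 : 1 + Real.log M ≤ (1 / Real.log 2 + 1) * L := by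
      have : 1 ≤ 1 / Real.log 2 * L := by
        rw [one_div_mul_eq_div, one_le_div hl2]; exact hL1
      linarith
    have h3 : L * L^(-α) = L^(1-α) := by
      rw [sub_eq_add_neg, Real.rpow_add hL0, Real.rpow_one]
    have h4 : L^(1-α) ≤ (Real.log C2)^(1-α) + 2^(1-α) * (Real.log N)^(1-α) := by
      rw [← Real.mul_rpow (by norm_num) hlN]
      calc L^(1-α) ≤ (Real.log C2 + 2 * Real.log N)^(1-α) := by
            apply Real.rpow_le_rpow hL0.le (by linarith) (by linarith)
        _ ≤ _ := Real.rpow_add_le_add_rpow hlC.le (by positivity) (by linarith) (by linarith)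
    have h5 : L^(1-α) ≤ B * (1 + (Real.log N)^(1-α)) := by
      have p1 : 0 ≤ (Real.log N)^(1-α) := by positivity
      have p2 : 0 ≤ (Real.log C2)^(1-α) := by positivity
      have p3 : (0:ℝ) ≤ 2^(1-α) := by positivity
      rw [hB]
      nlinarith [mul_nonneg p1 p2]
    rw [if_pos h0, one_mul]
    calc _ ≤ ((1 / Real.log 2 + 1) * L) * L^(-α) := by
          gcongr
          exact h1.trans h2
      _ = (1 / Real.log 2 + 1) * L^(1-α) := by rw [mul_assoc, h3]
      _ ≤ (1 / Real.log 2 + 1) * (B * (1 + (Real.log N)^(1-α))) := by gcongr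
      _ = _ := by ring
  · have hs : Summable (fun n : ℕ => 1 / (n:ℝ)^(1-σ)) := Real.summable_one_div_nat_rpow.mpr (by
      have := lt_of_le_of_ne hσ h0
      linarith)
    have hts : 0 ≤ ∑' n : ℕ, 1 / (n:ℝ)^(1-σ) := tsum_nonneg (fun n => by positivity)
    refine ⟨(1 + ∑' n : ℕ, 1 / (n:ℝ)^(1-σ)) * (Real.log 2)^(-α), by positivity, ?_⟩
    intro M N hM hN hMN
    rw [if_neg h0, zero_mul, add_zero, mul_one]
    have h1 : ∑ m ∈ Finset.Icc 1 M, 1 / (m:ℝ)^(1-σ) ≤ ∑' n : ℕ, 1 / (n:ℝ)^(1-σ) := hs.sum_le_tsum _ (fun n _ => by positivity)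
    have h2 : (Real.log ((M:ℝ) * N))^(-α) ≤ (Real.log 2)^(-α) :=
      Real.rpow_le_rpow_of_nonpos hl2 (hL M N hM hN) (by linarith)
    have hL0 : 0 < Real.log ((M:ℝ) * N) := lt_of_lt_of_le hl2 (hL M N hM hN)
    apply mul_le_mul _ h2 (by positivity) (by positivity)
    linarith

lemma pm_bound (d θ : ℝ) (hd : 0 < d) (m M N : ℕ) (hm : 1 ≤ m) (hmM : m ≤ M) (x : ℝ)
    (hx : x ∈ Set.Icc (1:ℝ) N) :
    |pm d θ m x| ≤ d * Real.log ((M:ℝ) * N) + (d * |Real.log d| + |θ|) := by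
  have hm1 : (1:ℝ) ≤ m := by exact_mod_cast hm
  have hmM1 : (m:ℝ) ≤ M := by exact_mod_cast hmM
  have hN1 : (1:ℝ) ≤ N := hx.1.trans hx.2
  have a1 : 0 ≤ Real.log m := Real.log_nonneg hm1
  have a2 : Real.log m ≤ Real.log M := Real.log_le_log (by linarith) hmM1
  have a3 : 0 ≤ Real.log x := Real.log_nonneg hx.1
  have a4 : Real.log x ≤ Real.log N := Real.log_le_log (by linarith [hx.1]) hx.2
  have hLs : Real.log ((M:ℝ) * N) = Real.log M + Real.log N := Real.log_mul (by linarith) (by linarith)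
  unfold pm
  have b1 : |Real.log m - Real.log d - Real.log x| ≤ Real.log ((M:ℝ) * N) + |Real.log d| := by
    rw [hLs, abs_le]
    constructor <;> linarith [neg_abs_le (Real.log d), le_abs_self (Real.log d)]
  calc _ ≤ |d * (Real.log m - Real.log d - Real.log x)| + |θ| := abs_add_le _ _
    _ = d * |Real.log m - Real.log d - Real.log x| + |θ| := by rw [abs_mul, abs_of_pos hd]
    _ ≤ d * (Real.log ((M:ℝ) * N) + |Real.log d|) + |θ| := by gcongr
    _ = _ := by ring

lemma fm_mul_exp (d θ : ℝ) (m : ℕ) (h : ℤ) (x : ℝ) :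
    Complex.exp (2 * (Real.pi : ℂ) * Complex.I * ((Fm d θ m x - (h : ℝ) * x : ℝ) : ℂ)) / ((Real.sqrt x : ℝ) : ℂ)
      = fm d θ m x * Complex.exp (-(2 * Real.pi * Complex.I * h * x)) := by
  unfold fm
  rw [div_mul_eq_mul_div, ← Complex.exp_add]
  congr 2
  push_cast
  ring

set_option maxHeartbeats 3000000 in
theorem statement11 (σ d θ : ℝ) (hσ : σ ≤ 0) (hd : 0 < d)
    (α : ℝ) (hα0 : 0 < α) (hα1 : α ≤ 1) (C1 C2 : ℝ) (hC1 : 1 < C1) (hC12 : C1 < C2) :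
    ∃ c > (0 : ℝ), ∃ C > (0 : ℝ), ∀ M N : ℕ, 0 < M → 0 < N →
      C1 * N ≤ M → (M : ℝ) ≤ C2 * N →
      ‖(∑ n ∈ Finset.Icc 1 N,
            riemannZeta ((σ : ℂ) + 2 * (Real.pi : ℂ) * Complex.I * (d : ℂ) * (n : ℂ)) *
              Complex.exp (2 * (Real.pi : ℂ) * Complex.I * (θ : ℂ) * (n : ℂ)) /
                ((((n : ℝ) ^ (1 - σ) : ℝ)) : ℂ))
          - (Complex.exp (2 * (Real.pi : ℂ) * Complex.I / 8) *
                (((d ^ ((1 : ℝ) / 2 - σ) : ℝ)) : ℂ)) *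
              ∑ m ∈ Finset.Icc 1 M, (1 / ((((m : ℝ) ^ (1 - σ) : ℝ)) : ℂ)) *
                ∑ h ∈ Finset.Icc (-⌊c * (Real.log ((M : ℝ) * N)) ^ (1 + α)⌋)
                    ⌊c * (Real.log ((M : ℝ) * N)) ^ (1 + α)⌋,
                  ∫ x in (1 : ℝ)..(N : ℝ),
                    Complex.exp (2 * (Real.pi : ℂ) * Complex.I *
                        ((Fm d θ m x - (h : ℝ) * x : ℝ) : ℂ)) / ((Real.sqrt x : ℝ) : ℂ)‖
        ≤ C * (1 + (if σ = 0 then 1 else 0) * (Real.log N) ^ (1 - α)) := by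
  have hl2 : 0 < Real.log 2 := Real.log_pos (by norm_num)
  have hC2 : 1 < C2 := hC1.trans hC12
  have hlC : 0 < Real.log C2 := Real.log_pos hC2
  have ha : 1 ≤ 1 - σ := by linarith
  have hsA := summ_A (1-σ) d ha hd
  obtain ⟨KB, hKB, hB⟩ := sum_B (1-σ) d ha hd
  obtain ⟨KT, hKT, hT⟩ := trunc_pt (1-σ) d ha hd
  obtain ⟨KQ, hKQ, hQ⟩ := Q_bound σ α C2 hσ hα0 hα1 hC2
  have exp_half : (1:ℝ)/2 - σ = (1 - σ) - 1/2 := by ring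
  rw [exp_half]
  set a : ℝ := 1 - σ with had
  set gA : ℕ → ℝ := fun n : ℕ => ‖riemannZeta (1 - wn a d n) - chiX a (2 * Real.pi * d * n) * riemannZeta (wn a d n)‖ / (n:ℝ)^a with hgA
  have hSA : 0 ≤ ∑' n, gA n := tsum_nonneg (fun n => by simp only [hgA]; positivity)
  set D : ℂ := Complex.exp (2 * (Real.pi : ℂ) * Complex.I / 8) * (((d ^ (a - 1/2) : ℝ)) : ℂ) with hD
  set K0 : ℝ := d + (d * |Real.log d| + |θ|) / Real.log 2 with hK0
  have hK00 : 0 < K0 := by positivity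
  set c : ℝ := 2 * K0 / (Real.log 2)^α with hc
  have hc0 : 0 < c := by positivity
  set KR : ℝ := 2 * (4 * Real.pi * K0 + (4 * Real.pi * d + 3) / Real.log 2) / c with hKR
  have hKR0 : 0 < KR := by positivity
  set C : ℝ := (∑' n, gA n) + d^(a-1/2) * KB + ‖D‖ * (KR * KQ) + ‖chiX a (2 * Real.pi * d * (1:ℕ))‖ * (‖riemannZeta (wn a d 1)‖ + KT * 2)
    + ‖D‖ * (3 + Real.log C2) with hC
  have hC0 : 0 < C := by positivity
  refine ⟨c, hc0, C, hC0, ?_⟩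
  intro M N hM hN hMN1 hMN2
  have hN1 : (1:ℝ) ≤ N := by exact_mod_cast hN
  have hMN : N ≤ M := by
    have : (N:ℝ) ≤ M := by nlinarith
    exact_mod_cast this
  have hM2 : 2 ≤ M := by
    have : (1:ℝ) < M := by nlinarith
    exact_mod_cast this
  have hM2r : (2:ℝ) ≤ M := by exact_mod_cast hM2
  have hM1 : 1 ≤ M := by omega
  set L : ℝ := Real.log ((M:ℝ) * N) with hLd
  have hL2 : Real.log 2 ≤ L := Real.log_le_log (by norm_num) (by nlinarith)
  have hL0 : 0 < L := by linarith
  set V : ℝ := 1 + (if σ = 0 then 1 else 0) * (Real.log N) ^ (1 - α) with hV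
  have hV1 : 1 ≤ V := by
    have h1 : 0 ≤ (Real.log N) ^ (1 - α) := Real.rpow_nonneg (Real.log_nonneg hN1) _
    have h2 : (0:ℝ) ≤ (if σ = 0 then 1 else 0) := by split_ifs <;> norm_num
    have := mul_nonneg h2 h1
    linarith
  -- choice of H
  obtain ⟨H, hH⟩ : ∃ H : ℕ, ⌊c * L ^ (1 + α)⌋ = (H:ℤ) :=
    Int.eq_ofNat_of_zero_le (Int.floor_nonneg.mpr (by positivity))
  have hHlt : c * L^(1+α) < H + 1 := by
    have := Int.lt_floor_add_one (c * L^(1+α))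
    rw [hH] at this
    exact_mod_cast this
  rw [hH]
  have hLpow : L^(1+α) = L * L^α := by rw [Real.rpow_add hL0, Real.rpow_one]
  have hcL : 2 * (K0 * L) ≤ c * L^(1+α) := by
    have h1 : (Real.log 2)^α ≤ L^α := Real.rpow_le_rpow hl2.le hL2 hα0.le
    have h2 : 0 < (Real.log 2)^α := by positivity
    rw [hLpow, hc]
    calc 2 * (K0 * L) = 2 * K0 / (Real.log 2)^α * (L * (Real.log 2)^α) := by field_simp
      _ ≤ _ := by gcongr
  -- per-m Poisson
  have hPm : ∀ m ∈ Finset.Icc 1 M,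
      ‖∑ n ∈ Finset.Icc 1 N, fm d θ m n - (fm d θ m 1 + fm d θ m N) / 2 -
      ∑ h ∈ Finset.Icc (-(H:ℤ)) H, ∫ x in (1:ℝ)..N, fm d θ m x * Complex.exp (-(2 * Real.pi * Complex.I * h * x))‖
      ≤ KR * L^(-α) := by
    intro m hm
    obtain ⟨hm1, hmM⟩ := Finset.mem_Icc.mp hm
    refine (poisson_m d θ hd m hm1 N hN (K0 * L) ?_ H (by linarith)).trans ?_
    · intro x hx
      refine (pm_bound d θ hd m M N hm1 hmM x hx).trans ?_
      rw [← hLd, hK0, add_mul]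
      gcongr
      rw [div_mul_eq_mul_div, le_div_iff₀ hl2]
      gcongr
    · have h1 : 4 * Real.pi * d + 3 ≤ (4 * Real.pi * d + 3) / Real.log 2 * L := by
        rw [div_mul_eq_mul_div, le_div_iff₀ hl2]
        gcongr
      calc 2 * (4 * Real.pi * (K0 * L) + 4 * Real.pi * d + 3) / (H+1)
          ≤ 2 * (4 * Real.pi * (K0 * L) + (4 * Real.pi * d + 3) / Real.log 2 * L) / (c * L^(1+α)) := by
            gcongr ?_ / ?_
            · linarith
        _ = _ := by
          rw [hKR, hLpow, Real.rpow_neg hL0.le]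
          have : 0 < L^α := by positivity
          field_simp
  -- rewrite integrals
  have hint : ∀ m : ℕ, ∑ h ∈ Finset.Icc (-(H:ℤ)) H, (∫ x in (1 : ℝ)..(N : ℝ),
        Complex.exp (2 * (Real.pi : ℂ) * Complex.I * ((Fm d θ m x - (h : ℝ) * x : ℝ) : ℂ)) / ((Real.sqrt x : ℝ) : ℂ))
      = ∑ h ∈ Finset.Icc (-(H:ℤ)) H, ∫ x in (1:ℝ)..N, fm d θ m x * Complex.exp (-(2 * Real.pi * Complex.I * h * x)) := by
    intro m
    apply Finset.sum_congr rfl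
    intro h _
    apply intervalIntegral.integral_congr
    intro x _
    exact fm_mul_exp d θ m h x
  simp only [hint]
  revert hPm
  generalize hI : (fun m : ℕ => ∑ h ∈ Finset.Icc (-(H:ℤ)) H, ∫ x in (1:ℝ)..N, fm d θ m x * Complex.exp (-(2 * Real.pi * Complex.I * h * x))) = I
  have hI' : ∀ m : ℕ, (∑ h ∈ Finset.Icc (-(H:ℤ)) H, ∫ x in (1:ℝ)..N, fm d θ m x * Complex.exp (-(2 * Real.pi * Complex.I * h * x))) = I m := fun m => by rw [← hI]
  simp only [hI']
  intro hPm
  -- notation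
  set e : ℕ → ℂ := fun n => Complex.exp (2 * (Real.pi : ℂ) * Complex.I * (θ : ℂ) * (n : ℂ)) with he
  have hen : ∀ n, ‖e n‖ = 1 := by
    intro n
    simp only [he]
    rw [Complex.norm_exp]; simp
  set T : ℕ → ℂ := fun n => ∑ m ∈ Finset.Icc 1 M, (m:ℂ)^(-(wn a d n)) with hTd
  set X : ℕ → ℂ := fun n => chiX a (2 * Real.pi * d * n) with hX
  set b : ℕ → ℂ := fun m => 1 / (((m : ℝ) ^ a : ℝ) : ℂ) with hb
  set pw : ℕ → ℂ := fun n => (((n : ℝ) ^ a : ℝ) : ℂ) with hpw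
  have hsn : ∀ n : ℕ, (σ : ℂ) + 2 * (Real.pi : ℂ) * Complex.I * (d : ℂ) * (n : ℂ) = 1 - wn a d n := by
    intro n
    rw [wn, had]; push_cast; ring
  have hpwn : ∀ n : ℕ, ‖pw n‖ = (n:ℝ)^a := by
    intro n
    simp only [hpw]
    rw [Complex.norm_real, Real.norm_of_nonneg (by positivity)]
  have hbn : ∀ m : ℕ, ‖b m‖ = 1 / (m:ℝ)^a := by
    intro m
    simp only [hb]
    rw [norm_div, norm_one, Complex.norm_real, Real.norm_of_nonneg (by positivity)]
  have hXT : ∀ n ∈ Finset.Icc 1 N, X n * T n * e n / pw n = D * ∑ m ∈ Finset.Icc 1 M, b m * fm d θ m n := by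
    intro n hn
    simp only [hTd]
    rw [Finset.mul_sum, Finset.sum_mul, Finset.sum_div, Finset.mul_sum]
    apply Finset.sum_congr rfl
    intro m hm
    exact ident_C a d θ hd m n (Finset.mem_Icc.mp hm).1 (Finset.mem_Icc.mp hn).1
  have hmain : ∑ n ∈ Finset.Icc 1 N, X n * T n * e n / pw n = D * ∑ m ∈ Finset.Icc 1 M, b m * ∑ n ∈ Finset.Icc 1 N, fm d θ m n := by
    rw [Finset.sum_congr rfl hXT, ← Finset.mul_sum, Finset.sum_comm]
    simp only [Finset.mul_sum]
  have hdecomp : (∑ n ∈ Finset.Icc 1 N, riemannZeta ((σ : ℂ) + 2 * (Real.pi : ℂ) * Complex.I * (d : ℂ) * (n : ℂ)) * e n / pw n)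
        - D * ∑ m ∈ Finset.Icc 1 M, b m * I m
      = (∑ n ∈ Finset.Icc 1 N, (riemannZeta (1 - wn a d n) - X n * riemannZeta (wn a d n)) * e n / pw n)
        + (∑ n ∈ Finset.Icc 1 N, X n / pw n * (riemannZeta (wn a d n) - T n) * e n)
        + D * (∑ m ∈ Finset.Icc 1 M, b m * (∑ n ∈ Finset.Icc 1 N, fm d θ m n - (fm d θ m 1 + fm d θ m N) / 2 - I m))
        + (D * ∑ m ∈ Finset.Icc 1 M, b m * fm d θ m 1) / 2
        + D * (∑ m ∈ Finset.Icc 1 M, b m * fm d θ m N) / 2 := by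
    have q1 : (∑ n ∈ Finset.Icc 1 N, riemannZeta ((σ : ℂ) + 2 * (Real.pi : ℂ) * Complex.I * (d : ℂ) * (n : ℂ)) * e n / pw n)
       = (∑ n ∈ Finset.Icc 1 N, (riemannZeta (1 - wn a d n) - X n * riemannZeta (wn a d n)) * e n / pw n)
        + (∑ n ∈ Finset.Icc 1 N, X n / pw n * (riemannZeta (wn a d n) - T n) * e n)
        + ∑ n ∈ Finset.Icc 1 N, X n * T n * e n / pw n := by
      rw [← Finset.sum_add_distrib, ← Finset.sum_add_distrib]
      apply Finset.sum_congr rfl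
      intro n _
      rw [hsn]
      ring
    have q2 : ∑ m ∈ Finset.Icc 1 M, b m * (∑ n ∈ Finset.Icc 1 N, fm d θ m n - (fm d θ m 1 + fm d θ m N) / 2 - I m)
       = (∑ m ∈ Finset.Icc 1 M, b m * ∑ n ∈ Finset.Icc 1 N, fm d θ m n) - (∑ m ∈ Finset.Icc 1 M, b m * fm d θ m 1)/2
        - (∑ m ∈ Finset.Icc 1 M, b m * fm d θ m N)/2 - ∑ m ∈ Finset.Icc 1 M, b m * I m := by
      rw [Finset.sum_div, Finset.sum_div, ← Finset.sum_sub_distrib, ← Finset.sum_sub_distrib, ← Finset.sum_sub_distrib]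
      apply Finset.sum_congr rfl
      intro m _
      ring
    rw [q1, hmain, q2]
    ring
  rw [hdecomp]
  -- the five bounds
  have n1 : ‖∑ n ∈ Finset.Icc 1 N, (riemannZeta (1 - wn a d n) - X n * riemannZeta (wn a d n)) * e n / pw n‖ ≤ ∑' n, gA n := by
    refine le_trans (norm_sum_le_of_le _ (n := gA) ?_) (hsA.sum_le_tsum _ (fun n _ => by simp only [hgA]; positivity))
    intro n _
    rw [norm_div, norm_mul, hen, mul_one, hpwn]
  have n2 : ‖∑ n ∈ Finset.Icc 1 N, X n / pw n * (riemannZeta (wn a d n) - T n) * e n‖ ≤ d^(a-1/2) * KB := by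
    refine le_trans (norm_sum_le_of_le _ (n := fun n : ℕ => d^(a-1/2) * (1 / Real.sqrt n * ‖riemannZeta (wn a d n) - T n‖)) ?_) ?_
    · intro n hn
      rw [norm_mul, norm_mul, hen, mul_one, norm_div, hpwn]
      simp only [hX]
      rw [norm_C a d hd n (Finset.mem_Icc.mp hn).1, mul_assoc]
    · rw [← Finset.mul_sum]
      gcongr
      exact hB M N hN hMN
  have n3 : ‖D * (∑ m ∈ Finset.Icc 1 M, b m * (∑ n ∈ Finset.Icc 1 N, fm d θ m n - (fm d θ m 1 + fm d θ m N) / 2 - I m))‖ ≤ ‖D‖ * (KR * KQ) * V := by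
    rw [norm_mul, mul_assoc]
    gcongr
    refine le_trans (norm_sum_le_of_le _ (n := fun m : ℕ => 1 / (m:ℝ)^a * (KR * L^(-α))) ?_) ?_
    · intro m hm
      rw [norm_mul, hbn]
      gcongr
      exact hPm m hm
    · rw [← Finset.sum_mul]
      have := hQ M N hM2 hN hMN2
      calc _ = KR * ((∑ m ∈ Finset.Icc 1 M, 1 / (m:ℝ)^a) * L^(-α)) := by ring
        _ ≤ KR * (KQ * V) := by gcongr
        _ = _ := by ring
  have n4 : ‖(D * ∑ m ∈ Finset.Icc 1 M, b m * fm d θ m 1) / 2‖ ≤ ‖X 1‖ * (‖riemannZeta (wn a d 1)‖ + KT * 2) := by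
    have h1 := hXT 1 (Finset.mem_Icc.mpr ⟨le_refl _, hN⟩)
    rw [Nat.cast_one] at h1
    rw [← h1, norm_div, norm_div, norm_mul, norm_mul, hen, hpwn, Nat.cast_one, Real.one_rpow, mul_one, div_one]
    have h2 : ‖T 1‖ ≤ ‖riemannZeta (wn a d 1)‖ + KT * 2 := by
      have h3 := hT 1 M le_rfl hM1 _ rfl
      rw [← wn] at h3
      have h4 : (1:ℝ) / (1:ℕ) + Real.sqrt (1:ℕ) / M ≤ 2 := by
        rw [Nat.cast_one, Real.sqrt_one, div_one]
        have : 1 / (M:ℝ) ≤ 1 := by rw [div_le_one (by linarith)]; linarith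
        linarith
      have h5 : ‖riemannZeta (wn a d 1) - T 1‖ ≤ KT * 2 := h3.trans (by gcongr)
      have h6 : T 1 = riemannZeta (wn a d 1) - (riemannZeta (wn a d 1) - T 1) := by ring
      rw [h6]
      exact norm_sub_le_of_le le_rfl h5
    have h7 : ‖(2:ℂ)‖ = 2 := by norm_num
    rw [h7]
    have h8 := mul_le_mul_of_nonneg_left h2 (norm_nonneg (X 1))
    have h9 : 0 ≤ ‖X 1‖ * ‖T 1‖ := by positivity
    linarith
  have n5 : ‖D * (∑ m ∈ Finset.Icc 1 M, b m * fm d θ m N) / 2‖ ≤ ‖D‖ * (3 + Real.log C2) := by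
    have hs0 : 1 ≤ Real.sqrt N := Real.one_le_sqrt.mpr hN1
    have h1 : ‖∑ m ∈ Finset.Icc 1 M, b m * fm d θ m N‖ ≤ 3 + Real.log C2 := by
      refine le_trans (norm_sum_le_of_le _ (n := fun m : ℕ => 1 / (m:ℝ)^a * (1 / Real.sqrt N)) ?_) ?_
      · intro m _
        rw [norm_mul, hbn, fm_norm]
      · rw [← Finset.sum_mul, mul_one_div, div_le_iff₀ (by linarith)]
        have h2 := pow_sum_le a ha M
        have hlM : Real.log M ≤ Real.log C2 + Real.log N := by
          rw [← Real.log_mul (by linarith) (by linarith)]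
          exact Real.log_le_log (by linarith) hMN2
        have h3 : Real.log N ≤ (N:ℝ)^(1/2:ℝ) / (1/2) := Real.log_le_rpow_div (by linarith) (by norm_num)
        rw [← Real.sqrt_eq_rpow] at h3
        nlinarith
    rw [norm_div, norm_mul]
    have h7 : ‖(2:ℂ)‖ = 2 := by norm_num
    rw [h7]
    have h8 := mul_le_mul_of_nonneg_left h1 (norm_nonneg D)
    have h9 : 0 ≤ ‖D‖ * ‖∑ m ∈ Finset.Icc 1 M, b m * fm d θ m N‖ := by positivity
    linarith
  have htot := norm_add_le_of_le (norm_add_le_of_le (norm_add_le_of_le (norm_add_le_of_le n1 n2) n3) n4) n5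
  refine htot.trans ?_
  have g1 : ∑' n, gA n ≤ (∑' n, gA n) * V := le_mul_of_one_le_right hSA hV1
  have g2 : d^(a-1/2) * KB ≤ (d^(a-1/2) * KB) * V := le_mul_of_one_le_right (by positivity) hV1
  have g4 : ‖X 1‖ * (‖riemannZeta (wn a d 1)‖ + KT * 2) ≤ (‖X 1‖ * (‖riemannZeta (wn a d 1)‖ + KT * 2)) * V := le_mul_of_one_le_right (by positivity) hV1
  have g5 : ‖D‖ * (3 + Real.log C2) ≤ (‖D‖ * (3 + Real.log C2)) * V := le_mul_of_one_le_right (by positivity) hV1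
  have hCe : C * V = (∑' n, gA n) * V + (d^(a-1/2) * KB) * V + (‖D‖ * (KR * KQ)) * V + (‖X 1‖ * (‖riemannZeta (wn a d 1)‖ + KT * 2)) * V + (‖D‖ * (3 + Real.log C2)) * V := by
    rw [hC]; ring
  rw [hCe]
  linarith
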